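/- arXiv:1306.5323 — 10 statements merged into one kernel-verified Lean document; each statement's English description precedes it below -/
import Mathlib

section
/- If in addition Q_{φφ|θ} is positive definite, then for every t×q real matrix G the information gain is bounded above by the information that φ itself would bring: D(G) ≤ (1/2)·log det(I_p + Mᵀ Q_{φφ|θ}⁻¹ M Q_{θθ|x}). -/
open Matrix

/-- The information gain of the secondary channel matrix `G`. -/
noncomputable def infoGain {p q t : ℕ}
    (Qθx : Matrix (Fin p) (Fin p) ℝ) (M : Matrix (Fin q) (Fin p) ℝ)
    (Qφθ : Matrix (Fin q) (Fin q) ℝ) (Qv : Matrix (Fin t) (Fin t) ℝ)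
    (G : Matrix (Fin t) (Fin q) ℝ) : ℝ :=
  (1 / 2 : ℝ) *
    Real.log ((1 + Mᵀ * Gᵀ * (G * Qφθ * Gᵀ + Qv)⁻¹ * G * M * Qθx).det)

/-- The determinant of `1 + C` is at least one for positive semidefinite `C`. -/
theorem Matrix.PosSemidef.one_le_det_one_add {n : Type*} [Fintype n] [DecidableEq n]
    {C : Matrix n n ℝ} (hC : C.PosSemidef) : 1 ≤ (1 + C).det := by
  have hH : (1 + C).IsHermitian := isHermitian_one.add hC.1
  rw [hH.det_eq_prod_eigenvalues, ← Finset.prod_const_one (s := (Finset.univ : Finset n))]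
  refine Finset.prod_le_prod (fun _ _ => zero_le_one) fun i _ => ?_
  have hv : (⇑(hH.eigenvectorBasis i) : n → ℝ) ≠ 0 := fun h => by
    have := hH.eigenvectorBasis.orthonormal.ne_zero i
    exact this (PiLp.ext fun j => congrFun h j)
  have hpos := dotProduct_star_self_pos_iff.mpr hv
  have hnn := hC.dotProduct_mulVec_nonneg (⇑(hH.eigenvectorBasis i))
  have hev := hH.mulVec_eigenvectorBasis i
  rw [add_mulVec, one_mulVec, ← eq_sub_iff_add_eq'] at hev
  rw [hev, dotProduct_sub, dotProduct_smul, smul_eq_mul] at hnn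
  simp only [RCLike.ofReal_real_eq_id, id_eq]
  nlinarith

open scoped MatrixOrder in
/-- The determinant is monotone on positive definite matrices. -/
theorem Matrix.PosDef.det_le_det_add {n : Type*} [Fintype n] [DecidableEq n]
    {A B : Matrix n n ℝ} (hA : A.PosDef) (hB : B.PosSemidef) : A.det ≤ (A + B).det := by
  obtain ⟨D, rfl⟩ := CStarAlgebra.nonneg_iff_eq_star_mul_self.mp hB.nonneg
  have hfac : A + star D * D = A * (1 + A⁻¹ * star D * D) := by
    rw [mul_add, mul_one, ← mul_assoc, mul_nonsing_inv_cancel_left _ _ hA.det_pos.ne'.isUnit]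
  have hpsd : (D * (A⁻¹ * star D)).PosSemidef := by
    rw [← mul_assoc]
    exact hA.inv.posSemidef.mul_mul_conjTranspose_same D
  rw [hfac, det_mul, det_one_add_mul_comm]
  exact le_mul_of_one_le_right hA.det_pos.le hpsd.one_le_det_one_add

/-- Observing a linear image with additional noise is less precise than observing the
variable itself: `Gᵀ (G Q Gᵀ + R)⁻¹ G ≤ Q⁻¹` in the Loewner order. -/
theorem Matrix.PosDef.posSemidef_inv_sub_conj_inv {m n : Type*} [Fintype m] [Fintype n]
    [DecidableEq m] [DecidableEq n] {Q : Matrix n n ℝ} {R : Matrix m m ℝ}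
    (hQ : Q.PosDef) (hR : R.PosDef) (G : Matrix m n ℝ) :
    (Q⁻¹ - Gᵀ * (G * Q * Gᵀ + R)⁻¹ * G).PosSemidef := by
  rw [← conjTranspose_eq_transpose_of_trivial]
  have hK : (G * Q * Gᴴ + R).PosDef :=
    PosDef.posSemidef_add (hQ.posSemidef.mul_mul_conjTranspose_same G) hR
  let _ := invertibleOfIsUnitDet _ hK.det_pos.ne'.isUnit
  let _ := invertibleOfIsUnitDet _ hQ.inv.det_pos.ne'.isUnit
  rw [← PosDef.fromBlocks₁₁ G Q⁻¹ hK,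
    PosDef.fromBlocks₂₂ _ G hQ.inv, nonsing_inv_nonsing_inv _ hQ.det_pos.ne'.isUnit,
    add_sub_cancel_left]
  exact hR.posSemidef

/-- if moreover `Qφθ` is positive definite, the information gain is
bounded above by the information that φ itself would bring. -/
theorem infoGain_le (p q t : ℕ) (hp : 0 < p) (hq : 0 < q) (ht : 0 < t)
    (Qθx : Matrix (Fin p) (Fin p) ℝ) (hQθx : Qθx.PosDef)
    (M : Matrix (Fin q) (Fin p) ℝ)
    (Qφθ : Matrix (Fin q) (Fin q) ℝ) (hQφθ : Qφθ.PosSemidef)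
    (Qv : Matrix (Fin t) (Fin t) ℝ) (hQv : Qv.PosDef)
    (hQφθpd : Qφθ.PosDef)
    (G : Matrix (Fin t) (Fin q) ℝ) :
    infoGain Qθx M Qφθ Qv G ≤
      (1 / 2 : ℝ) * Real.log ((1 + Mᵀ * Qφθ⁻¹ * M * Qθx).det) := by
  have hfac (X : Matrix (Fin p) (Fin p) ℝ) :
      (1 + X * Qθx).det = (Qθx⁻¹ + X).det * Qθx.det := by
    rw [← det_mul, add_mul, nonsing_inv_mul _ hQθx.det_pos.ne'.isUnit]
  set K := G * Qφθ * Gᵀ + Qv with hK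
  have hKpd : K.PosDef :=
    PosDef.posSemidef_add (hQφθ.mul_mul_conjTranspose_same G) hQv
  have hX : (Mᵀ * Gᵀ * K⁻¹ * G * M).PosSemidef := by
    simpa [Matrix.mul_assoc] using hKpd.inv.posSemidef.conjTranspose_mul_mul_same (G * M)
  have hdiff : (Mᵀ * Qφθ⁻¹ * M - Mᵀ * Gᵀ * K⁻¹ * G * M).PosSemidef := by
    simpa [hK, Matrix.mul_assoc, Matrix.mul_sub, Matrix.sub_mul] using
      (hQφθpd.posSemidef_inv_sub_conj_inv hQv G).conjTranspose_mul_mul_same M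
  have hpd := hQθx.inv.add_posSemidef hX
  have hle := hpd.det_le_det_add hdiff
  rw [add_assoc, add_sub_cancel] at hle
  rw [infoGain, ← hK, hfac, hfac]
  gcongr
  · exact mul_pos hpd.det_pos hQθx.det_pos
  · exact hQθx.det_pos.le
end

section
/- It suffices to maximize the information gain on the boundary of the power constraint: let P > 0 and let G be a nonzero t×q real matrix with tr(G Gᵀ) < P. Then the rescaled matrix G̃ = (√P / ‖G‖_F)·G, where ‖G‖_F = √tr(G Gᵀ) is the Frobenius norm, satisfies tr(G̃ G̃ᵀ) = P and D(G̃) ≥ D(G). -/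
open Matrix

namespace Matrix

section RCLike

variable {n 𝕜 : Type*} [Fintype n] [DecidableEq n] [RCLike 𝕜]

open scoped ComplexOrder

open scoped MatrixOrder in
theorem PosSemidef.exists_eq_conjTranspose_mul_self {A : Matrix n n 𝕜} (hA : A.PosSemidef) :
    ∃ B : Matrix n n 𝕜, A = Bᴴ * B :=
  CStarAlgebra.nonneg_iff_eq_star_mul_self.mp hA.nonneg

theorem PosDef.posSemidef_inv_sub_inv {A B : Matrix n n 𝕜} (hA : A.PosDef) (hB : B.PosDef)
    (hAB : (B - A).PosSemidef) : (A⁻¹ - B⁻¹).PosSemidef := by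
  let := hB.isUnit.invertible
  let := hA.inv.isUnit.invertible
  have h₁ := PosDef.fromBlocks₁₁ (1 : Matrix n n 𝕜) A⁻¹ hB
  have h₂ := PosDef.fromBlocks₂₂ B (1 : Matrix n n 𝕜) hA.inv
  simp only [conjTranspose_one, Matrix.one_mul, Matrix.mul_one,
    nonsing_inv_nonsing_inv A ((isUnit_iff_isUnit_det A).1 hA.isUnit)] at h₁ h₂
  exact h₁.1 (h₂.2 hAB)

end RCLike

section Real

variable {m n : Type*} [Fintype m] [Fintype n] [DecidableEq n]

theorem PosSemidef.one_le_det_one_add_s3 {S : Matrix n n ℝ} (hS : S.PosSemidef) :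
    1 ≤ (1 + S).det := by
  have h : (1 + S).det = ∏ i, (1 + hS.1.eigenvalues i) := by
    have h₁ := congrArg (Polynomial.eval (-1)) hS.1.charpoly_eq
    rw [eval_charpoly, Polynomial.eval_prod] at h₁
    have h₂ : scalar n (-1 : ℝ) - S = -(1 + S) := by
      rw [map_neg, map_one]; abel
    have h₃ : ∀ i, -1 - hS.1.eigenvalues i = -(1 + hS.1.eigenvalues i) := fun i => by ring
    simp only [h₂, det_neg, Polynomial.eval_sub, Polynomial.eval_X, Polynomial.eval_C,
      RCLike.ofReal_real_eq_id, id, h₃, Finset.prod_neg, Finset.card_univ] at h₁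
    exact mul_left_cancel₀ (pow_ne_zero _ (by norm_num)) h₁
  rw [h]
  exact Finset.one_le_prod fun i _ => le_add_of_nonneg_right (hS.eigenvalues_nonneg i)

theorem PosDef.det_le_det_of_posSemidef_sub {X Y : Matrix n n ℝ} (hX : X.PosDef)
    (hXY : (Y - X).PosSemidef) : X.det ≤ Y.det := by
  obtain ⟨F, hF⟩ := hXY.exists_eq_conjTranspose_mul_self
  have hdet := (isUnit_iff_isUnit_det X).1 hX.isUnit
  have hY : Y = X * (1 + (X⁻¹ * Fᴴ) * F) := by
    rw [Matrix.mul_add, Matrix.mul_one, ← Matrix.mul_assoc, ← Matrix.mul_assoc,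
      mul_nonsing_inv X hdet, Matrix.one_mul, ← hF, add_sub_cancel]
  rw [hY, det_mul, det_one_add_mul_comm, ← Matrix.mul_assoc]
  exact le_mul_of_one_le_right hX.det_pos.le
    (hX.posSemidef.inv.mul_mul_conjTranspose_same F).one_le_det_one_add_s3

theorem det_one_add_transpose_mul_mul_mono {W W' : Matrix m m ℝ} (hW : W.PosSemidef)
    (hWW' : (W' - W).PosSemidef) (H : Matrix m n ℝ) {Q : Matrix n n ℝ} (hQ : Q.PosSemidef) :
    0 < (1 + Hᵀ * W * H * Q).det ∧
      (1 + Hᵀ * W * H * Q).det ≤ (1 + Hᵀ * W' * H * Q).det := by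
  obtain ⟨B, rfl⟩ := hQ.exists_eq_conjTranspose_mul_self
  have key (V : Matrix m m ℝ) :
      (1 + Hᵀ * V * H * (Bᴴ * B)).det = (1 + (H * Bᴴ)ᴴ * V * (H * Bᴴ)).det := by
    rw [← Matrix.mul_assoc, det_one_add_mul_comm]
    simp only [conjTranspose_eq_transpose_of_trivial, transpose_mul, transpose_transpose,
      Matrix.mul_assoc]
  have hX := PosDef.one.add_posSemidef (hW.conjTranspose_mul_mul_same (H * Bᴴ))
  rw [key, key]
  refine ⟨hX.det_pos, hX.det_le_det_of_posSemidef_sub ?_⟩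
  rw [add_sub_add_left_eq_sub, ← Matrix.sub_mul, ← Matrix.mul_sub]
  exact hWW'.conjTranspose_mul_mul_same _

end Real

end Matrix

theorem infoGain_le_infoGain_smul {p q t : ℕ}
    {Qθx : Matrix (Fin p) (Fin p) ℝ} (hQθx : Qθx.PosSemidef)
    (M : Matrix (Fin q) (Fin p) ℝ)
    {Qφθ : Matrix (Fin q) (Fin q) ℝ} (hQφθ : Qφθ.PosSemidef)
    {Qv : Matrix (Fin t) (Fin t) ℝ} (hQv : Qv.PosDef)
    (G : Matrix (Fin t) (Fin q) ℝ) {c : ℝ} (hc : 1 ≤ c) :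
    infoGain Qθx M Qφθ Qv G ≤ infoGain Qθx M Qφθ Qv (c • G) := by
  have hc0 : 0 < c := one_pos.trans_le hc
  have hR : (G * Qφθ * Gᵀ).PosSemidef := by
    simpa using hQφθ.mul_mul_conjTranspose_same G
  have hN : (G * Qφθ * Gᵀ + Qv).PosDef := hQv.posSemidef_add hR
  have hN' : (G * Qφθ * Gᵀ + (c ^ 2)⁻¹ • Qv).PosDef :=
    (hQv.smul (by positivity)).posSemidef_add hR
  have hsub : (G * Qφθ * Gᵀ + Qv - (G * Qφθ * Gᵀ + (c ^ 2)⁻¹ • Qv)).PosSemidef := by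
    rw [add_sub_add_left_eq_sub]
    have h : Qv - (c ^ 2)⁻¹ • Qv = (1 - (c ^ 2)⁻¹) • Qv := by rw [sub_smul, one_smul]
    rw [h]
    exact hQv.posSemidef.smul (sub_nonneg.2 (inv_le_one_of_one_le₀ (one_le_pow₀ hc)))
  have hscale : (c • G) * Qφθ * (c • G)ᵀ + Qv = c ^ 2 • (G * Qφθ * Gᵀ + (c ^ 2)⁻¹ • Qv) := by
    rw [smul_add, smul_inv_smul₀ (by positivity), transpose_smul]
    simp only [Matrix.smul_mul, Matrix.mul_smul, smul_smul, sq]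
  have hinv : (c ^ 2 • (G * Qφθ * Gᵀ + (c ^ 2)⁻¹ • Qv))⁻¹ =
      (c ^ 2)⁻¹ • (G * Qφθ * Gᵀ + (c ^ 2)⁻¹ • Qv)⁻¹ := by
    refine inv_eq_right_inv ?_
    rw [Matrix.smul_mul, Matrix.mul_smul, smul_inv_smul₀ (by positivity),
      mul_nonsing_inv _ ((isUnit_iff_isUnit_det _).1 hN'.isUnit)]
  have hgain : Mᵀ * (c • G)ᵀ * ((c • G) * Qφθ * (c • G)ᵀ + Qv)⁻¹ * (c • G) * M * Qθx =
      (G * M)ᵀ * (G * Qφθ * Gᵀ + (c ^ 2)⁻¹ • Qv)⁻¹ * (G * M) * Qθx := by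
    rw [hscale, hinv]
    simp only [transpose_smul, transpose_mul, Matrix.smul_mul, Matrix.mul_smul, smul_smul,
      Matrix.mul_assoc]
    have h : c * ((c ^ 2)⁻¹ * c) = 1 := by field_simp
    simp [h]
  have hgain₀ : Mᵀ * Gᵀ * (G * Qφθ * Gᵀ + Qv)⁻¹ * G * M * Qθx =
      (G * M)ᵀ * (G * Qφθ * Gᵀ + Qv)⁻¹ * (G * M) * Qθx := by
    simp only [transpose_mul, Matrix.mul_assoc]
  obtain ⟨hpos, hle⟩ := det_one_add_transpose_mul_mul_mono hN.inv.posSemidef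
    (hN'.posSemidef_inv_sub_inv hN hsub) (G * M) hQθx
  unfold infoGain
  rw [hgain, hgain₀]
  gcongr

/-- rescaling a matrix with `tr(G Gᵀ) < P` to the boundary of the
power constraint does not decrease the information gain. -/
theorem infoGain_rescale_boundary (p q t : ℕ) (hp : 0 < p) (hq : 0 < q) (ht : 0 < t)
    (Qθx : Matrix (Fin p) (Fin p) ℝ) (hQθx : Qθx.PosDef)
    (M : Matrix (Fin q) (Fin p) ℝ)
    (Qφθ : Matrix (Fin q) (Fin q) ℝ) (hQφθ : Qφθ.PosSemidef)
    (Qv : Matrix (Fin t) (Fin t) ℝ) (hQv : Qv.PosDef)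
    (P : ℝ) (hP : 0 < P)
    (G : Matrix (Fin t) (Fin q) ℝ) (hG : G ≠ 0)
    (hGP : trace (G * Gᵀ) < P) :
    trace (((Real.sqrt P / Real.sqrt (trace (G * Gᵀ))) • G) *
        ((Real.sqrt P / Real.sqrt (trace (G * Gᵀ))) • G)ᵀ) = P ∧
      infoGain Qθx M Qφθ Qv G ≤
        infoGain Qθx M Qφθ Qv ((Real.sqrt P / Real.sqrt (trace (G * Gᵀ))) • G) := by
  have htr : 0 < trace (G * Gᵀ) := by
    have h0 := (posSemidef_self_mul_conjTranspose G).trace_nonneg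
    have hne := mt trace_mul_conjTranspose_self_eq_zero_iff.1 hG
    rw [conjTranspose_eq_transpose_of_trivial] at h0 hne
    exact lt_of_le_of_ne h0 (Ne.symm hne)
  refine ⟨?_, infoGain_le_infoGain_smul hQθx.posSemidef M hQφθ hQv G ?_⟩
  · rw [transpose_smul, Matrix.smul_mul, Matrix.mul_smul, smul_smul, trace_smul, smul_eq_mul,
      div_mul_div_comm, Real.mul_self_sqrt hP.le, Real.mul_self_sqrt htr.le,
      div_mul_cancel₀ _ htr.ne']
  · rw [one_le_div (Real.sqrt_pos.2 htr)]
    exact Real.sqrt_le_sqrt hGP.le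
end

section
/- (Lemma 1) Suppose 0 < σ²_{v,1} < σ²_{v,2} < … < σ²_{v,t} (distinct, increasing) and that for some ρ with 1 ≤ ρ ≤ t one has σ²_{ξ,1} > σ²_{ξ,2} > … > σ²_{ξ,ρ} > 0 and σ²_{ξ,j} = 0 for all j > ρ. Let P > 0 and suppose Φ maximizes D(Φ) over all t×q real matrices with tr(Φ Φᵀ) ≤ P. Then every row of Φ contains at most one nonzero entry, every column of Φ contains at most one nonzero entry, and every nonzero entry of Φ lies in one of the first ρ columns. -/
open Matrix

/-- The information gain of a `t × q` channel matrix `Φ`, for diagonal noise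
covariance `Σ_v = diagonal σv` and diagonal signal covariance `Σ_ξ = diagonal σξ`. -/
noncomputable def infoGainPhi {t q : ℕ} (σv : Fin t → ℝ) (σξ : Fin q → ℝ)
    (Φ : Matrix (Fin t) (Fin q) ℝ) : ℝ :=
  (1 / 2 : ℝ) *
    Real.log ((1 + Φᵀ * (Φ * Φᵀ + diagonal σv)⁻¹ * Φ * diagonal σξ).det)

open Filter Topology in
theorem HasDerivAt.nonpos_of_eventually_le {f : ℝ → ℝ} {a d : ℝ} (hf : HasDerivAt f d a)
    (h : ∀ᶠ ε in 𝓝[>] (0 : ℝ), f (a + ε) ≤ f a) : d ≤ 0 := by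
  refine le_of_tendsto hf.tendsto_slope_zero_right ?_
  filter_upwards [h, self_mem_nhdsWithin] with ε hε hpos
  exact smul_nonpos_of_nonneg_of_nonpos (inv_nonneg.2 (le_of_lt hpos)) (sub_nonpos.2 hε)

namespace Matrix

variable {m n : Type*} [Fintype m] [Fintype n]

open Filter Topology in
/-- If a linear functional `H ↦ tr (G Hᵀ)` is nonpositive wherever `H ↦ tr (Φ Hᵀ)` is negative,
then `G` is a multiple of `Φ`. -/
theorem exists_eq_smul_of_trace_nonpos {G Φ : Matrix m n ℝ} (hΦ : Φ ≠ 0)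
    (h : ∀ H : Matrix m n ℝ, (Φ * Hᵀ).trace < 0 → (G * Hᵀ).trace ≤ 0) :
    ∃ μ : ℝ, G = μ • Φ := by
  have hpos : 0 < (Φ * Φᵀ).trace := by
    refine lt_of_le_of_ne ?_ fun h0 => hΦ ?_
    · simpa using (posSemidef_self_mul_conjTranspose Φ).trace_nonneg
    · exact trace_mul_conjTranspose_self_eq_zero_iff.1 (by simpa using h0.symm)
  refine ⟨(G * Φᵀ).trace / (Φ * Φᵀ).trace, ?_⟩
  set μ := (G * Φᵀ).trace / (Φ * Φᵀ).trace with hμ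
  have hμ' : (G * Φᵀ).trace = μ * (Φ * Φᵀ).trace := by rw [hμ]; field_simp
  have hcomm : (Φ * Gᵀ).trace = (G * Φᵀ).trace := by
    rw [← trace_transpose]; simp
  set E := G - μ • Φ with hE
  have hΦE : (Φ * Eᵀ).trace = 0 := by
    simp [hE, Matrix.mul_sub, hcomm, hμ']
  have hEE : (G * Eᵀ).trace = (E * Eᵀ).trace := by
    have : G = E + μ • Φ := by simp [hE]
    conv_lhs => rw [this]
    simp [Matrix.add_mul, hΦE]
  have hle : (E * Eᵀ).trace ≤ 0 := by
    have hlim : Tendsto (fun ε : ℝ => (E * Eᵀ).trace - ε * (G * Φᵀ).trace) (𝓝[>] 0)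
        (𝓝 ((E * Eᵀ).trace - 0 * (G * Φᵀ).trace)) := by
      refine Tendsto.mono_left (Continuous.tendsto (by fun_prop) 0) nhdsWithin_le_nhds
    rw [zero_mul, sub_zero] at hlim
    refine le_of_tendsto hlim ?_
    filter_upwards [self_mem_nhdsWithin] with ε hε
    have := h (E - ε • Φ) (by
      simpa [Matrix.mul_sub, hΦE] using mul_pos hε hpos)
    simpa [Matrix.mul_sub, hEE] using this
  have hzero : E = 0 := trace_mul_conjTranspose_self_eq_zero_iff.1 (by
    refine le_antisymm (by simpa using hle) (posSemidef_self_mul_conjTranspose E).trace_nonneg)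
  exact sub_eq_zero.1 hzero

variable [DecidableEq m] [DecidableEq n]

open Polynomial in
theorem hasDerivAt_det_one_add_smul_add_sq_smul (X Y : Matrix n n ℝ) :
    HasDerivAt (fun ε : ℝ => (1 + ε • X + ε ^ 2 • Y).det) X.trace 0 := by
  have key := det_one_add_smul (Polynomial.X : ℝ[X])
    (X.map C + (Polynomial.X : ℝ[X]) • Y.map C)
  set M : Matrix n n ℝ[X] := X.map C + (Polynomial.X : ℝ[X]) • Y.map C with hM
  have heval : (fun ε : ℝ => (1 + ε • X + ε ^ 2 • Y).det) =
      fun ε => ((1 + (Polynomial.X : ℝ[X]) • M).det).eval ε := by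
    funext ε
    rw [← coe_evalRingHom, RingHom.map_det]
    congr 1
    ext i j
    simp only [hM, RingHom.mapMatrix_apply, map_apply, add_apply, smul_apply, smul_eq_mul,
      coe_evalRingHom, eval_add, eval_mul, eval_X, eval_C, one_apply, apply_ite (eval ε), eval_one,
      eval_zero]
    ring
  have htr : M.trace.eval 0 = X.trace := by
    simp [hM, trace, eval_finsetSum]
  rw [heval]
  have hd := ((1 + (Polynomial.X : ℝ[X]) • M).det).hasDerivAt 0
  have hd0 : (derivative (1 + (Polynomial.X : ℝ[X]) • M).det).eval 0 = X.trace := by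
    rw [key]
    simp [htr]
  rwa [hd0] at hd

theorem hasDerivAt_log_det {A : Matrix n n ℝ} (hA : 0 < A.det) (X Y : Matrix n n ℝ) :
    HasDerivAt (fun ε : ℝ => Real.log (A + ε • X + ε ^ 2 • Y).det) (A⁻¹ * X).trace 0 := by
  have hu : IsUnit A.det := hA.ne'.isUnit
  have h := (hasDerivAt_det_one_add_smul_add_sq_smul (A⁻¹ * X) (A⁻¹ * Y)).const_mul A.det
  have heq : (fun ε : ℝ => (A + ε • X + ε ^ 2 • Y).det) =
      fun ε => A.det * (1 + ε • (A⁻¹ * X) + ε ^ 2 • (A⁻¹ * Y)).det := by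
    funext ε
    rw [← det_mul]
    simp [mul_add, mul_nonsing_inv_cancel_left A _ hu]
  rw [← heq] at h
  convert h.log (by simpa using hA.ne') using 1
  simp [hA.ne']

theorem posDef_mul_diagonal_mul_transpose_add {σ : m → ℝ} (hσ : ∀ i, 0 < σ i) {d : n → ℝ}
    (hd : ∀ j, 0 ≤ d j) (Φ : Matrix m n ℝ) :
    (Φ * diagonal d * Φᵀ + diagonal σ).PosDef := by
  refine PosDef.posSemidef_add ?_ (PosDef.diagonal hσ)
  simpa using (PosSemidef.diagonal (d := d) hd).mul_mul_conjTranspose_same Φ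

/-- The log-determinant of `A = Φ Λ Φᵀ + Σ`, along `Φ + ε H`, has at `ε = 0` the derivative
`2 tr (A⁻¹ Φ Λ Hᵀ)`. -/
theorem hasDerivAt_log_det_congruence {σ : m → ℝ} (hσ : ∀ i, 0 < σ i) {d : n → ℝ}
    (hd : ∀ j, 0 ≤ d j) (Φ H : Matrix m n ℝ) :
    HasDerivAt
      (fun ε : ℝ => Real.log ((Φ + ε • H) * diagonal d * (Φ + ε • H)ᵀ + diagonal σ).det)
      (2 * ((Φ * diagonal d * Φᵀ + diagonal σ)⁻¹ * Φ * diagonal d * Hᵀ).trace) 0 := by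
  have hA := posDef_mul_diagonal_mul_transpose_add hσ hd Φ
  set A := Φ * diagonal d * Φᵀ + diagonal σ with hAdef
  have hsymm : (A⁻¹)ᵀ = A⁻¹ := by simpa using hA.inv.isHermitian.eq
  have htr : (A⁻¹ * (H * diagonal d * Φᵀ)).trace = (A⁻¹ * Φ * diagonal d * Hᵀ).trace := by
    rw [← trace_transpose]
    simp only [transpose_mul, transpose_transpose, diagonal_transpose, hsymm]
    rw [trace_mul_comm]
    simp only [Matrix.mul_assoc]
  convert hasDerivAt_log_det hA.det_pos (H * diagonal d * Φᵀ + Φ * diagonal d * Hᵀ)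
    (H * diagonal d * Hᵀ) using 1
  · funext ε
    congr 2
    simp only [hAdef, transpose_add, transpose_smul, Matrix.add_mul, Matrix.mul_add,
      Matrix.smul_mul, Matrix.mul_smul, smul_add, smul_smul, pow_two]
    abel
  · rw [mul_add, trace_add, htr]
    simp only [Matrix.mul_assoc]
    ring

/-- A symmetric matrix that stays symmetric after scaling its columns by distinct factors is
diagonal. -/
theorem IsSymm.apply_eq_zero_of_mul_diagonal {C : Matrix m m ℝ} {σ : m → ℝ}
    (hσ : Function.Injective σ) (hC : C.IsSymm) (hCσ : (C * diagonal σ).IsSymm) {i k : m}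
    (hik : i ≠ k) : C i k = 0 := by
  have h1 := hCσ.apply i k
  rw [mul_diagonal, mul_diagonal, hC.apply i k] at h1
  have h2 : C i k * (σ i - σ k) = 0 := by linarith
  exact (mul_eq_zero.1 h2).resolve_right (sub_ne_zero.2 (hσ.ne hik))

end Matrix

section InfoGain

variable {t q : ℕ} {σv : Fin t → ℝ} {σξ : Fin q → ℝ}

theorem infoGainPhi_eq_log_sub_log (hv : ∀ i, 0 < σv i) (hξ : ∀ j, 0 ≤ σξ j)
    (Φ : Matrix (Fin t) (Fin q) ℝ) :
    infoGainPhi σv σξ Φ = (1 / 2 : ℝ) *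
      (Real.log (Φ * diagonal (1 + σξ) * Φᵀ + diagonal σv).det -
        Real.log (Φ * diagonal (1 : Fin q → ℝ) * Φᵀ + diagonal σv).det) := by
  have hA := posDef_mul_diagonal_mul_transpose_add hv (d := 1 + σξ)
    (fun j => add_nonneg zero_le_one (hξ j)) Φ
  have hB := posDef_mul_diagonal_mul_transpose_add hv (d := 1) (fun _ => zero_le_one) Φ
  have hone : (diagonal (1 : Fin q → ℝ) : Matrix (Fin q) (Fin q) ℝ) = 1 := diagonal_one
  have hsplit : (diagonal (1 + σξ) : Matrix (Fin q) (Fin q) ℝ) = 1 + diagonal σξ := by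
    rw [← hone, diagonal_add]; rfl
  rw [infoGainPhi, ← Real.log_div hA.det_pos.ne' hB.det_pos.ne']
  rw [hone, Matrix.mul_one] at hB ⊢
  have hu : IsUnit (Φ * Φᵀ + diagonal σv).det := hB.det_pos.ne'.isUnit
  congr 2
  rw [eq_div_iff hB.det_pos.ne']
  have hcomm : (1 + Φᵀ * (Φ * Φᵀ + diagonal σv)⁻¹ * Φ * diagonal σξ).det =
      (1 + (Φ * Φᵀ + diagonal σv)⁻¹ * (Φ * diagonal σξ * Φᵀ)).det := by
    rw [Matrix.mul_assoc, Matrix.mul_assoc, det_one_add_mul_comm]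
    simp only [Matrix.mul_assoc]
  rw [hcomm, mul_comm, ← det_mul, Matrix.mul_add, mul_nonsing_inv_cancel_left _ _ hu, hsplit]
  congr 1
  simp only [Matrix.mul_add, Matrix.add_mul, Matrix.mul_one]
  abel

/-- Concentrating the power on one entry with positive signal variance gives positive gain. -/
theorem infoGainPhi_single_pos (hv : ∀ i, 0 < σv i) (hξ : ∀ j, 0 ≤ σξ j) (i : Fin t) {j : Fin q}
    (hj : 0 < σξ j) {c : ℝ} (hc : c ≠ 0) : 0 < infoGainPhi σv σξ (Matrix.single i j c) := by
  have hcov : ∀ d : Fin q → ℝ,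
      Matrix.single i j c * diagonal d * (Matrix.single i j c)ᵀ + diagonal σv =
        diagonal fun k => (Pi.single i (c * c * d j) : Fin t → ℝ) k + σv k := by
    intro d
    have hd : Matrix.single i j c * diagonal d = Matrix.single i j (c * d j) := by
      ext a b
      rw [mul_diagonal, single_apply, single_apply]
      split_ifs with h
      · rw [h.2]
      · rw [zero_mul]
    rw [hd, transpose_single, single_mul_single_same, ← diagonal_single, diagonal_add,
      mul_right_comm]
  have hc2 : 0 < c * c := mul_self_pos.2 hc
  have hpos : ∀ k, 0 < (Pi.single i (c * c * 1) : Fin t → ℝ) k + σv k := fun k => by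
    have h0 : 0 ≤ (Pi.single i (c * c * 1) : Fin t → ℝ) := Pi.single_nonneg.2 (by linarith)
    exact add_pos_of_nonneg_of_pos (h0 k) (hv k)
  rw [infoGainPhi_eq_log_sub_log hv hξ, hcov, hcov, det_diagonal, det_diagonal]
  refine mul_pos one_half_pos (sub_pos.2 (Real.log_lt_log (Finset.prod_pos fun k _ => hpos k) ?_))
  have hgrow : c * c * 1 < c * c * (1 + σξ j) := by nlinarith
  refine Finset.prod_lt_prod (fun k _ => hpos k) (fun k _ => ?_) ⟨i, Finset.mem_univ i, ?_⟩
  · exact add_le_add_left (Pi.single_le_single.2 hgrow.le k) _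
  · simpa using hgrow

open Filter Topology in
/-- First-order optimality of a nonzero maximizer under the power constraint. -/
theorem exists_multiplier_of_maximizer (hv : ∀ i, 0 < σv i) (hξ : ∀ j, 0 ≤ σξ j) {P : ℝ}
    {Φ : Matrix (Fin t) (Fin q) ℝ} (hΦ : Φ ≠ 0) (hΦP : trace (Φ * Φᵀ) ≤ P)
    (hmax : ∀ Ψ : Matrix (Fin t) (Fin q) ℝ, trace (Ψ * Ψᵀ) ≤ P →
      infoGainPhi σv σξ Ψ ≤ infoGainPhi σv σξ Φ) :
    ∃ μ : ℝ, (Φ * diagonal (1 + σξ) * Φᵀ + diagonal σv)⁻¹ * Φ * diagonal (1 + σξ) -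
      (Φ * diagonal (1 : Fin q → ℝ) * Φᵀ + diagonal σv)⁻¹ * Φ * diagonal (1 : Fin q → ℝ) = μ • Φ := by
  refine exists_eq_smul_of_trace_nonpos hΦ fun H hH => ?_
  have hd := ((hasDerivAt_log_det_congruence hv (d := 1 + σξ)
    (fun j => add_nonneg zero_le_one (hξ j)) Φ H).sub
    (hasDerivAt_log_det_congruence hv (d := 1) (fun _ => zero_le_one) Φ H)).const_mul (1 / 2 : ℝ)
  have hle := hd.nonpos_of_eventually_le ?_
  · rw [Matrix.sub_mul, trace_sub]
    linarith
  have hcomm : (H * Φᵀ).trace = (Φ * Hᵀ).trace := by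
    rw [← trace_transpose]; simp
  have hlim : Tendsto (fun ε : ℝ => 2 * (Φ * Hᵀ).trace + ε * (H * Hᵀ).trace) (𝓝[>] 0)
      (𝓝 (2 * (Φ * Hᵀ).trace + 0 * (H * Hᵀ).trace)) :=
    Tendsto.mono_left (Continuous.tendsto (by fun_prop) 0) nhdsWithin_le_nhds
  have hneg := hlim.eventually_lt_const (u := 0) (by linarith)
  filter_upwards [hneg, self_mem_nhdsWithin] with ε hε hεpos
  have hfeas : trace ((Φ + ε • H) * (Φ + ε • H)ᵀ) ≤ P := by
    have : trace ((Φ + ε • H) * (Φ + ε • H)ᵀ) = trace (Φ * Φᵀ) +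
        ε * (2 * (Φ * Hᵀ).trace + ε * (H * Hᵀ).trace) := by
      simp [Matrix.add_mul, Matrix.mul_add, hcomm]
      ring
    rw [this]
    linarith [mul_neg_of_pos_of_neg hεpos hε]
  have := hmax _ hfeas
  rw [infoGainPhi_eq_log_sub_log hv hξ, infoGainPhi_eq_log_sub_log hv hξ] at this
  simpa using this

end InfoGain

/-- Lemma 1: a maximizer `Φ` of the information gain under the
power constraint has at most one nonzero entry in each row and each column, and
all nonzero entries lie in the first ρ columns. -/
theorem maximizer_structure (t q : ℕ) (ht : 0 < t) (htq : t ≤ q)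
    (σv : Fin t → ℝ) (σξ : Fin q → ℝ)
    (hσv_pos : ∀ i, 0 < σv i) (hσv_mono : StrictMono σv)
    (ρ : ℕ) (hρ1 : 1 ≤ ρ) (hρt : ρ ≤ t)
    (hσξ_pos : ∀ j : Fin q, (j : ℕ) < ρ → 0 < σξ j)
    (hσξ_anti : ∀ i j : Fin q, i < j → (j : ℕ) < ρ → σξ j < σξ i)
    (hσξ_zero : ∀ j : Fin q, ρ ≤ (j : ℕ) → σξ j = 0)
    (P : ℝ) (hP : 0 < P)
    (Φ : Matrix (Fin t) (Fin q) ℝ)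
    (hΦP : trace (Φ * Φᵀ) ≤ P)
    (hΦmax : ∀ Ψ : Matrix (Fin t) (Fin q) ℝ, trace (Ψ * Ψᵀ) ≤ P →
      infoGainPhi σv σξ Ψ ≤ infoGainPhi σv σξ Φ) :
    (∀ i : Fin t, ∀ j j' : Fin q, Φ i j ≠ 0 → Φ i j' ≠ 0 → j = j') ∧
      (∀ j : Fin q, ∀ i i' : Fin t, Φ i j ≠ 0 → Φ i' j ≠ 0 → i = i') ∧
      (∀ (i : Fin t) (j : Fin q), Φ i j ≠ 0 → (j : ℕ) < ρ) := by
  have hξ : ∀ j, 0 ≤ σξ j := fun j => by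
    rcases lt_or_ge (j : ℕ) ρ with h | h
    · exact (hσξ_pos j h).le
    · exact (hσξ_zero j h).ge
  rcases eq_or_ne Φ 0 with rfl | hΦ
  · simp
  obtain ⟨μ, hμ⟩ := exists_multiplier_of_maximizer hσv_pos hξ hΦ hΦP hΦmax
  have hA := posDef_mul_diagonal_mul_transpose_add hσv_pos (d := 1 + σξ)
    (fun j => add_nonneg zero_le_one (hξ j)) Φ
  have hB := posDef_mul_diagonal_mul_transpose_add hσv_pos (d := 1) (fun _ => zero_le_one) Φ
  have hgain := infoGainPhi_eq_log_sub_log hσv_pos hξ Φ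
  set A := Φ * diagonal (1 + σξ) * Φᵀ + diagonal σv with hAdef
  set B := Φ * diagonal (1 : Fin q → ℝ) * Φᵀ + diagonal σv with hBdef
  have hAu : IsUnit A.det := hA.det_pos.ne'.isUnit
  have hBu : IsUnit B.det := hB.det_pos.ne'.isUnit
  have hkey : (B⁻¹ - A⁻¹) * diagonal σv = μ • (Φ * Φᵀ) := by
    have h1 : A⁻¹ * (Φ * diagonal (1 + σξ) * Φᵀ) = 1 - A⁻¹ * diagonal σv := by
      rw [eq_sub_iff_add_eq, ← Matrix.mul_add, ← hAdef, nonsing_inv_mul _ hAu]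
    have h2 : B⁻¹ * (Φ * diagonal (1 : Fin q → ℝ) * Φᵀ) = 1 - B⁻¹ * diagonal σv := by
      rw [eq_sub_iff_add_eq, ← Matrix.mul_add, ← hBdef, nonsing_inv_mul _ hBu]
    rw [← smul_mul, ← hμ, Matrix.sub_mul, Matrix.sub_mul]
    simp only [Matrix.mul_assoc] at h1 h2 ⊢
    rw [h1, h2]
    abel
  have hμ0 : μ ≠ 0 := by
    rintro rfl
    have hdv : IsUnit (diagonal σv).det := by
      rw [det_diagonal]
      exact (Finset.prod_pos fun i _ => hσv_pos i).ne'.isUnit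
    have hAB : B⁻¹ = A⁻¹ := by
      rw [zero_smul] at hkey
      have := congrArg (· * (diagonal σv)⁻¹) hkey
      simp only [mul_nonsing_inv_cancel_right _ _ hdv, Matrix.zero_mul] at this
      exact sub_eq_zero.1 this
    have hAB' : A = B := by
      rw [← nonsing_inv_nonsing_inv A hAu, ← hAB, nonsing_inv_nonsing_inv B hBu]
    have h0 := infoGainPhi_single_pos hσv_pos hξ ⟨0, ht⟩
      (hσξ_pos ⟨0, ht.trans_le htq⟩ hρ1) (Real.sqrt_pos.2 hP).ne'
    have h1 := hΦmax (Matrix.single ⟨0, ht⟩ ⟨0, ht.trans_le htq⟩ (Real.sqrt P)) (by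
      rw [transpose_single, single_mul_single_same, trace_single_eq_same,
        Real.mul_self_sqrt hP.le])
    rw [hgain, hAB', sub_self, mul_zero] at h1
    exact absurd h0 h1.not_gt
  have hAs : (A⁻¹).IsSymm := by simpa [IsSymm] using hA.inv.isHermitian.eq
  have hBs : (B⁻¹).IsSymm := by simpa [IsSymm] using hB.inv.isHermitian.eq
  have hrow : ∀ i k, i ≠ k → (Φ * Φᵀ) i k = 0 := by
    intro i k hik
    have hC := (hBs.sub hAs).apply_eq_zero_of_mul_diagonal hσv_mono.injective
      (by rw [hkey]; simp [IsSymm]) hik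
    have := congrFun (congrFun hkey i) k
    rw [mul_diagonal, hC, zero_mul, Matrix.smul_apply, smul_eq_mul] at this
    exact (mul_eq_zero.1 this.symm).resolve_left hμ0
  have hBdiag : B = diagonal fun i => (Φ * Φᵀ) i i + σv i := by
    ext i k
    have hone : (diagonal (1 : Fin q → ℝ) : Matrix (Fin q) (Fin q) ℝ) = 1 := diagonal_one
    rw [hBdef, hone, Matrix.mul_one, Matrix.add_apply]
    rcases eq_or_ne i k with rfl | hik
    · simp
    · simp [hrow i k hik, hik]
  have hBinv : ∀ i k, i ≠ k → B⁻¹ i k = 0 := by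
    intro i k hik
    rw [hBdiag, inv_diagonal, diagonal_apply_ne _ hik]
  have hAinv : ∀ i k, i ≠ k → A⁻¹ i k = 0 := by
    intro i k hik
    have hC := (hBs.sub hAs).apply_eq_zero_of_mul_diagonal hσv_mono.injective
      (by rw [hkey]; simp [IsSymm]) hik
    rw [Matrix.sub_apply, hBinv i k hik] at hC
    linarith
  have hmul : ∀ {D : Matrix (Fin t) (Fin t) ℝ}, (∀ i k, i ≠ k → D i k = 0) →
      ∀ i j, (D * Φ) i j = D i i * Φ i j := by
    intro D hD i j
    rw [mul_apply, Finset.sum_eq_single i (fun k _ hk => by rw [hD i k hk.symm, zero_mul])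
      (by simp)]
  have hentry : ∀ i j, Φ i j ≠ 0 → A⁻¹ i i * (1 + σξ j) = B⁻¹ i i + μ := by
    intro i j hij
    have := congrFun (congrFun hμ i) j
    rw [Matrix.sub_apply, mul_diagonal, mul_diagonal, hmul hAinv, hmul hBinv, Matrix.smul_apply,
      smul_eq_mul, Pi.add_apply, Pi.one_apply, mul_one] at this
    refine mul_right_cancel₀ hij ?_
    linarith
  have hsupp : ∀ (i : Fin t) (j : Fin q), Φ i j ≠ 0 → (j : ℕ) < ρ := by
    intro i j hij
    by_contra! hj
    have h1 := hentry i j hij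
    rw [hσξ_zero j hj, add_zero, mul_one] at h1
    have h2 := congrFun (congrFun hkey i) i
    rw [mul_diagonal, Matrix.sub_apply, Matrix.smul_apply, smul_eq_mul, h1] at h2
    have h3 : 0 ≤ (Φ * Φᵀ) i i := by
      simpa using (posSemidef_self_mul_conjTranspose Φ).diag_nonneg (i := i)
    have h4 : μ * ((Φ * Φᵀ) i i + σv i) = 0 := by linarith
    exact (mul_ne_zero hμ0 (add_pos_of_nonneg_of_pos h3 (hσv_pos i)).ne') h4
  have hone_per_row : ∀ i : Fin t, ∀ j j' : Fin q, Φ i j ≠ 0 → Φ i j' ≠ 0 → j = j' := by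
    intro i j j' hj hj'
    have h := mul_left_cancel₀ hA.inv.diag_pos.ne' ((hentry i j hj).trans (hentry i j' hj').symm)
    rcases lt_trichotomy j j' with hlt | heq | hlt
    · linarith [hσξ_anti j j' hlt (hsupp i j' hj')]
    · exact heq
    · linarith [hσξ_anti j' j hlt (hsupp i j hj)]
  refine ⟨hone_per_row, fun j i i' hi hi' => ?_, hsupp⟩
  by_contra hne
  have h := hrow i i' hne
  rw [mul_apply, Finset.sum_eq_single j (fun k _ hk => ?_) (by simp)] at h
  · exact mul_ne_zero hi hi' h
  · by_contra hk0
    exact hk (hone_per_row i k j (left_ne_zero_of_mul hk0) hi)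
end

section
/- (Theorem 1) Assume Q_{φφ|θ} = I_q, t ≤ q, and the eigendecompositions Q_{vv} = U_v Σ_v U_vᵀ and M Q_{θθ|x} Mᵀ = U_ξ Σ_ξ U_ξᵀ, where U_v (t×t) and U_ξ (q×q) are orthogonal, Σ_v is diagonal with distinct increasing positive diagonal entries 0 < σ²_{v,1} < … < σ²_{v,t}, and Σ_ξ is diagonal with σ²_{ξ,1} > … > σ²_{ξ,ρ} > 0 and σ²_{ξ,j} = 0 for j > ρ, for some 1 ≤ ρ ≤ t. Let P > 0, and suppose μ > 0 and κ ∈ {1, …, ρ} satisfy: 2μσ²_{v,i} < σ²_{ξ,i} for all i ≤ κ, 2μσ²_{v,i} ≥ σ²_{ξ,i} for all κ < i ≤ ρ, and ∑_{i=1}^{κ} λ*²_{ii} = P, where for i ≤ κ, λ*²_{ii} = (σ²_{v,i} / (2(1+σ²_{ξ,i})))·( −(2+σ²_{ξ,i}) + √( σ⁴_{ξ,i} + 4(1+σ²_{ξ,i})σ²_{ξ,i}/(2μσ²_{v,i}) ) ), and λ*_{ii} = 0 for κ < i ≤ t. Let Λ* be the t×q diagonal matrix with diagonal entries λ*_{11},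 …, λ*_{tt} and G* = U_v Λ* U_ξᵀ. Then tr(G* G*ᵀ) = P and G* maximizes the information gain: D(G*) ≥ D(G) for every t×q real matrix G with tr(G Gᵀ) ≤ P. -/
open Matrix

theorem Matrix.IsHermitian.exists_antitone_diagonalization {n : ℕ} {A : Matrix (Fin n) (Fin n) ℝ}
    (hA : A.IsHermitian) :
    ∃ (X : Matrix (Fin n) (Fin n) ℝ) (d : Fin n → ℝ),
      Antitone d ∧ Xᵀ * X = 1 ∧ X * Xᵀ = 1 ∧ A = X * diagonal d * Xᵀ := by
  let U : Matrix (Fin n) (Fin n) ℝ := hA.eigenvectorUnitary.1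
  have hUU : Uᵀ * U = 1 := by
    have := Unitary.coe_star_mul_self hA.eigenvectorUnitary
    simpa [star_eq_conjTranspose] using this
  have hUU' : U * Uᵀ = 1 := mul_eq_one_comm.1 hUU
  have hspec : A = U * diagonal hA.eigenvalues * Uᵀ := by
    have := hA.spectral_theorem
    rw [Unitary.conjStarAlgAut_apply] at this
    simpa [star_eq_conjTranspose, Function.comp_def] using this
  let e : Equiv.Perm (Fin n) := Tuple.sort (fun i => - hA.eigenvalues i)
  refine ⟨U.submatrix id e, hA.eigenvalues ∘ e, ?_, ?_, ?_, ?_⟩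
  · intro i j hij
    have := Tuple.monotone_sort (fun i => - hA.eigenvalues i) hij
    simpa [e] using this
  · rw [transpose_submatrix, ← submatrix_mul _ _ _ _ _ Function.bijective_id, hUU]
    exact submatrix_one_equiv e
  · rw [transpose_submatrix, ← submatrix_mul _ _ _ _ _ e.bijective, hUU', submatrix_id_id]
  · rw [← submatrix_diagonal_equiv, transpose_submatrix,
      ← submatrix_mul _ _ _ _ _ e.bijective, ← submatrix_mul _ _ _ _ _ e.bijective,
      submatrix_id_id, ← hspec]

theorem dotProduct_conj_diagonal_mulVec {m n : ℕ} (X : Matrix (Fin m) (Fin n) ℝ) (d : Fin n → ℝ)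
    (x : Fin m → ℝ) :
    x ⬝ᵥ (X * diagonal d * Xᵀ) *ᵥ x = ∑ j, d j * (Xᵀ *ᵥ x) j ^ 2 := by
  rw [← mulVec_mulVec, ← mulVec_mulVec, dotProduct_mulVec, ← mulVec_transpose]
  simp only [dotProduct, mulVec_diagonal]
  exact Finset.sum_congr rfl fun j _ => by ring

/-- The quadratic form of `B` is at most `b * (x ⬝ᵥ x)` on a subspace of codimension at most `i`. -/
def QuadBoundOnCodim {n : ℕ} (B : Matrix (Fin n) (Fin n) ℝ) (i : ℕ) (b : ℝ) : Prop :=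
  ∃ L : (Fin n → ℝ) →ₗ[ℝ] (Fin i → ℝ), ∀ x, L x = 0 → x ⬝ᵥ B *ᵥ x ≤ b * (x ⬝ᵥ x)

theorem QuadBoundOnCodim.compress {m n : ℕ} {B : Matrix (Fin n) (Fin n) ℝ} {i : ℕ} {b : ℝ}
    (h : QuadBoundOnCodim B i b) (J : Matrix (Fin n) (Fin m) ℝ) (hJ : Jᵀ * J = 1) :
    QuadBoundOnCodim (Jᵀ * B * J) i b := by
  obtain ⟨L, hL⟩ := h
  refine ⟨L ∘ₗ J.mulVecLin, fun x hx => ?_⟩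
  have h1 := hL (J *ᵥ x) hx
  have h2 : ∀ y : Fin n → ℝ, J *ᵥ x ⬝ᵥ y = x ⬝ᵥ Jᵀ *ᵥ y := fun y => by
    rw [dotProduct_mulVec, vecMul_transpose]
  rw [h2, h2, mulVec_mulVec, mulVec_mulVec, mulVec_mulVec, hJ, one_mulVec] at h1
  exact h1

theorem Matrix.PosSemidef.posDef_one_add_smul {n : ℕ} {B : Matrix (Fin n) (Fin n) ℝ}
    (hB : B.PosSemidef) {c : ℝ} (hc : 0 ≤ c) : (1 + c • B).PosDef :=
  PosDef.one.add_posSemidef (hB.smul hc)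

theorem Matrix.PosSemidef.mul_inv_one_add_smul {n : ℕ} {B : Matrix (Fin n) (Fin n) ℝ}
    (hB : B.PosSemidef) {c : ℝ} (hc : 0 ≤ c) : (B * (1 + c • B)⁻¹).PosSemidef := by
  have hpd := hB.posDef_one_add_smul hc
  have hdet : IsUnit (1 + c • B).det := (isUnit_iff_isUnit_det _).1 hpd.isUnit
  have h1 : (B + c • (Bᴴ * B)).PosSemidef :=
    hB.add ((posSemidef_conjTranspose_mul_self B).smul hc)
  have h2 := h1.conjTranspose_mul_mul_same (1 + c • B)⁻¹
  rw [hpd.inv.isHermitian.eq, hB.isHermitian.eq] at h2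
  have h3 : B + c • (B * B) = (1 + c • B) * B := by
    rw [add_mul, one_mul, smul_mul_assoc]
  rw [h3, ← mul_assoc, nonsing_inv_mul _ hdet, one_mul] at h2
  exact h2

theorem QuadBoundOnCodim.mul_inv_one_add_smul {n : ℕ} {B : Matrix (Fin n) (Fin n) ℝ} {i : ℕ}
    {b c : ℝ} (h : QuadBoundOnCodim B i b) (hB : B.PosSemidef) (hc : 0 ≤ c) (hb : 0 ≤ b) :
    QuadBoundOnCodim (B * (1 + c • B)⁻¹) i (b / (1 + c * b)) := by
  rcases hc.eq_or_lt with rfl | hc'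
  · simpa using h
  obtain ⟨L, hL⟩ := h
  refine ⟨L, fun x hx => ?_⟩
  have hpd := hB.posDef_one_add_smul hc
  have hdet : IsUnit (1 + c • B).det := (isUnit_iff_isUnit_det _).1 hpd.isUnit
  have hpos : 0 < 1 + c * b := by positivity
  have hxB := hL x hx
  set z := (1 + c • B)⁻¹ *ᵥ x with hz
  have hzx : (1 + c • B) *ᵥ z = x := by
    rw [hz, mulVec_mulVec, mul_nonsing_inv _ hdet, one_mulVec]
  have hxz : x = z + c • B *ᵥ z := by
    conv_lhs => rw [← hzx]
    rw [add_mulVec, one_mulVec, smul_mulVec]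
  have hgoal : x ⬝ᵥ (B * (1 + c • B)⁻¹) *ᵥ x = x ⬝ᵥ B *ᵥ z := by rw [← mulVec_mulVec]
  have hlin : x ⬝ᵥ x = x ⬝ᵥ z + c * (x ⬝ᵥ B *ᵥ z) := by
    conv_lhs => rw [hxz]
    conv_lhs => rw [← hxz, dotProduct_comm]
    conv_lhs => enter [2]; rw [hxz]
    rw [dotProduct_add, dotProduct_smul, smul_eq_mul]
  set τ := 1 / (1 + c * b) with hτ
  have hsymm : z ⬝ᵥ (1 + c • B) *ᵥ x = x ⬝ᵥ x := by
    rw [dotProduct_mulVec, ← mulVec_transpose, ← conjTranspose_eq_transpose_of_trivial,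
      hpd.isHermitian.eq, hzx]
  have hq := hpd.posSemidef.dotProduct_mulVec_nonneg (z - τ • x)
  have hxx : x ⬝ᵥ (1 + c • B) *ᵥ x = x ⬝ᵥ x + c * (x ⬝ᵥ B *ᵥ x) := by
    rw [add_mulVec, one_mulVec, smul_mulVec, dotProduct_add, dotProduct_smul, smul_eq_mul]
  have hexp : star (z - τ • x) ⬝ᵥ (1 + c • B) *ᵥ (z - τ • x) =
      x ⬝ᵥ z - 2 * τ * (x ⬝ᵥ x) + τ ^ 2 * (x ⬝ᵥ x + c * (x ⬝ᵥ B *ᵥ x)) := by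
    rw [star_trivial, mulVec_sub, mulVec_smul, hzx, sub_dotProduct, dotProduct_sub,
      dotProduct_sub, smul_dotProduct, smul_dotProduct, dotProduct_smul, dotProduct_smul, hsymm,
      hxx, dotProduct_comm z x]
    simp only [smul_eq_mul]
    ring
  rw [hexp] at hq
  have h1 : τ ^ 2 * (x ⬝ᵥ x + c * (x ⬝ᵥ B *ᵥ x)) ≤ τ * (x ⬝ᵥ x) := by
    have h2 : x ⬝ᵥ x + c * (x ⬝ᵥ B *ᵥ x) ≤ (1 + c * b) * (x ⬝ᵥ x) := by nlinarith
    calc _ ≤ τ ^ 2 * ((1 + c * b) * (x ⬝ᵥ x)) := by gcongr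
      _ = τ * (x ⬝ᵥ x) := by rw [hτ]; field_simp
  have h3 : c * (x ⬝ᵥ B *ᵥ z) ≤ (1 - τ) * (x ⬝ᵥ x) := by nlinarith
  have h4 : 1 - τ = c * (b / (1 + c * b)) := by rw [hτ]; field_simp; ring
  rw [hgoal]
  rw [h4, mul_assoc] at h3
  exact le_of_mul_le_mul_left h3 hc'

theorem det_one_add_smul_le_prod {n : ℕ} {B : Matrix (Fin n) (Fin n) ℝ} (hB : B.PosSemidef)
    {c : ℝ} (hc : 0 ≤ c) {b : Fin n → ℝ} (hb : ∀ i : Fin n, QuadBoundOnCodim B i (b i)) :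
    (1 + c • B).det ≤ ∏ i, (1 + c * b i) := by
  obtain ⟨X, d, hd, hX, hX', hBX⟩ := hB.isHermitian.exists_antitone_diagonalization
  have hXmul : ∀ u : Fin n → ℝ, Xᵀ *ᵥ (X *ᵥ u) = u := fun u => by
    rw [mulVec_mulVec, hX, one_mulVec]
  have hnorm : ∀ u : Fin n → ℝ, X *ᵥ u ⬝ᵥ X *ᵥ u = ∑ j, u j ^ 2 := fun u => by
    rw [dotProduct_mulVec, ← mulVec_transpose, hXmul]
    simp [dotProduct, sq]
  have hquad : ∀ u : Fin n → ℝ, X *ᵥ u ⬝ᵥ B *ᵥ (X *ᵥ u) = ∑ j, d j * u j ^ 2 := fun u => by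
    rw [hBX, dotProduct_conj_diagonal_mulVec, hXmul]
  have hd0 : ∀ i, 0 ≤ d i := fun i => by
    have := hB.dotProduct_mulVec_nonneg (X *ᵥ Pi.single i 1)
    rw [star_trivial, hquad] at this
    simpa [Pi.single_apply] using this
  have hdb : ∀ i, d i ≤ b i := fun i => by
    obtain ⟨L, hL⟩ := hb i
    let J : Matrix (Fin n) (Fin (i + 1)) ℝ :=
      (1 : Matrix (Fin n) (Fin n) ℝ).submatrix id (Fin.castLE i.2)
    have hker := LinearMap.ker_ne_bot_of_finrank_lt (f := L ∘ₗ X.mulVecLin ∘ₗ J.mulVecLin)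
      (by simp)
    obtain ⟨w, hw, hw0⟩ := (Submodule.ne_bot_iff _).1 hker
    have hJw : ∀ k, (J *ᵥ w) (Fin.castLE i.2 k) = w k := fun k => by
      simp [J, mulVec, dotProduct, one_apply, Fin.ext_iff]
      simp [← Fin.ext_iff]
    have hJw0 : ∀ j : Fin n, i < j → (J *ᵥ w) j = 0 := fun j hj => by
      simp only [J, mulVec, dotProduct, submatrix_apply, id_eq, one_apply, ite_mul, one_mul,
        zero_mul]
      refine Finset.sum_eq_zero fun k _ => if_neg ?_
      rintro rfl
      have := k.2
      simp only [Fin.lt_def, Fin.val_castLE] at hj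
      omega
    have h1 := hL (X *ᵥ (J *ᵥ w)) hw
    rw [hquad, hnorm] at h1
    have h2 : d i * ∑ j, (J *ᵥ w) j ^ 2 ≤ ∑ j, d j * (J *ᵥ w) j ^ 2 := by
      rw [Finset.mul_sum]
      refine Finset.sum_le_sum fun j _ => ?_
      rcases lt_or_ge i j with h | h
      · simp [hJw0 j h]
      · exact mul_le_mul_of_nonneg_right (hd h) (sq_nonneg _)
    obtain ⟨k, hk⟩ := Function.ne_iff.1 hw0
    have h3 : 0 < ∑ j, (J *ᵥ w) j ^ 2 :=
      Finset.sum_pos' (fun j _ => sq_nonneg _) ⟨Fin.castLE i.2 k, Finset.mem_univ _, by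
        rw [hJw]; exact sq_pos_of_ne_zero hk⟩
    exact le_of_mul_le_mul_right (h2.trans h1) h3
  have hdet : (1 + c • B).det = ∏ i, (1 + c * d i) := by
    have : 1 + c • B = X * diagonal (fun i => 1 + c * d i) * Xᵀ := by
      have h1 : diagonal (fun i => 1 + c * d i) = 1 + c • diagonal d := by
        rw [← diagonal_one, ← diagonal_smul, diagonal_add]
        rfl
      rw [h1, mul_add, add_mul, mul_one, hX', hBX, mul_smul_comm, smul_mul_assoc]
    rw [this, mul_assoc, det_mul_comm, mul_assoc, hX, mul_one, det_diagonal]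
  rw [hdet]
  refine Finset.prod_le_prod (fun i _ => ?_) fun i _ => ?_
  · have := hd0 i; positivity
  · have := hdb i; gcongr

theorem submatrix_one_conj {m n : ℕ} (A : Matrix (Fin n) (Fin n) ℝ) (f : Fin m → Fin n) :
    ((1 : Matrix (Fin n) (Fin n) ℝ).submatrix id f)ᵀ * A *
      (1 : Matrix (Fin n) (Fin n) ℝ).submatrix id f = A.submatrix f f := by
  ext i j
  simp [mul_apply, one_apply]

theorem submatrix_one_transpose_mul_self {m n : ℕ} {f : Fin m → Fin n}
    (hf : Function.Injective f) :
    ((1 : Matrix (Fin n) (Fin n) ℝ).submatrix id f)ᵀ *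
      (1 : Matrix (Fin n) (Fin n) ℝ).submatrix id f = 1 := by
  have := submatrix_one_conj 1 f
  rwa [Matrix.mul_one, submatrix_one f hf] at this

theorem det_one_add_diagonal_mul_castSucc {n : ℕ} (s : Fin (n + 1) → ℝ) (hs : s (Fin.last n) = 0)
    (B : Matrix (Fin (n + 1)) (Fin (n + 1)) ℝ) :
    (1 + diagonal s * B).det =
      (1 + diagonal (s ∘ Fin.castSucc) * B.submatrix Fin.castSucc Fin.castSucc).det := by
  rw [det_succ_row _ (Fin.last n), Finset.sum_eq_single (Fin.last n)]
  · simp only [Matrix.add_apply, diagonal_mul, hs, zero_mul, add_zero, one_apply_eq, mul_one,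
      Fin.succAbove_last, Fin.val_last, ← two_mul, pow_mul]
    simp only [even_two, Even.neg_pow, one_pow, one_mul]
    refine congrArg det (Matrix.ext fun i j => ?_)
    simp [one_apply]
  · intro j _ hj
    simp [hs, one_apply_ne hj.symm]
  · simp

theorem det_one_add_diagonal_mul_le_prod {n : ℕ} {B : Matrix (Fin n) (Fin n) ℝ}
    (hB : B.PosSemidef) {s b : Fin n → ℝ} (hs : Antitone s) (hs0 : ∀ i, 0 ≤ s i)
    (hb0 : ∀ i, 0 ≤ b i) (hb : ∀ i : Fin n, QuadBoundOnCodim B i (b i)) :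
    (1 + diagonal s * B).det ≤ ∏ i, (1 + s i * b i) := by
  induction n with
  | zero => simp
  | succ n ih =>
    set c := s (Fin.last n) with hc_def
    have hc : 0 ≤ c := hs0 _
    have hpd := hB.posDef_one_add_smul hc
    have hdet : IsUnit (1 + c • B).det := (isUnit_iff_isUnit_det _).1 hpd.isUnit
    let s' : Fin (n + 1) → ℝ := fun i => s i - c
    set B' := B * (1 + c • B)⁻¹ with hB'
    have hsplit : 1 + diagonal s * B = (1 + diagonal s' * B') * (1 + c • B) := by
      have h1 : diagonal s = diagonal s' + c • (1 : Matrix (Fin (n + 1)) (Fin (n + 1)) ℝ) := by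
        rw [← diagonal_one, ← diagonal_smul, diagonal_add]
        congr 1
        ext i
        simp [s']
      rw [add_mul 1, one_mul, hB', mul_assoc, mul_assoc, nonsing_inv_mul _ hdet, mul_one, h1,
        add_mul, smul_mul_assoc, one_mul]
      abel
    let J : Matrix (Fin (n + 1)) (Fin n) ℝ :=
      (1 : Matrix (Fin (n + 1)) (Fin (n + 1)) ℝ).submatrix id Fin.castSucc
    have hJ : Jᵀ * J = 1 := submatrix_one_transpose_mul_self (Fin.castSucc_injective n)
    have hJB : Jᵀ * B' * J = B'.submatrix Fin.castSucc Fin.castSucc := submatrix_one_conj _ _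
    have hfac : ∀ i, 0 < 1 + c * b i := fun i => by
      have := hb0 i
      positivity
    have h1 : (1 + diagonal s' * B').det ≤
        ∏ i : Fin n, (1 + s' i.castSucc * (b i.castSucc / (1 + c * b i.castSucc))) := by
      rw [det_one_add_diagonal_mul_castSucc s' (sub_self c)]
      refine ih ((hB.mul_inv_one_add_smul hc).submatrix _) ?_ ?_ ?_ ?_
      · exact fun i j hij => sub_le_sub_right (hs (Fin.castSucc_le_castSucc_iff.2 hij)) c
      · exact fun i => sub_nonneg.2 (hs (Fin.le_last _))
      · exact fun i => div_nonneg (hb0 _) (hfac _).le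
      · intro i
        rw [← hJB]
        exact ((hb i.castSucc).mul_inv_one_add_smul hB hc (hb0 _)).compress J hJ
    have h2 := det_one_add_smul_le_prod hB hc hb
    rw [hsplit, det_mul]
    refine (mul_le_mul h1 h2 hpd.det_pos.le (Finset.prod_nonneg fun i _ => ?_)).trans_eq ?_
    · have h3 : 0 ≤ s' i.castSucc := sub_nonneg.2 (hs (Fin.le_last _))
      have h4 := hb0 i.castSucc
      positivity
    · rw [Fin.prod_univ_castSucc, Fin.prod_univ_castSucc, ← mul_assoc, ← Finset.prod_mul_distrib]
      refine congrArg₂ _ (Finset.prod_congr rfl fun i _ => ?_) rfl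
      have := (hfac i.castSucc).ne'
      simp only [s']
      field_simp
      ring

theorem sum_mul_le_trace_diagonal_mul_conj {n : ℕ} {v k : Fin n → ℝ} (hv : Monotone v)
    (hk : Antitone k) {X : Matrix (Fin n) (Fin n) ℝ} (hX : Xᵀ * X = 1) (hX' : X * Xᵀ = 1) :
    ∑ i, v i * k i ≤ trace (diagonal v * (X * diagonal k * Xᵀ)) := by
  let D : Matrix (Fin n) (Fin n) ℝ := of fun i j => X i j ^ 2
  have hD : D ∈ doublyStochastic ℝ (Fin n) := by
    refine mem_doublyStochastic_iff_sum.2 ⟨fun i j => sq_nonneg _, fun i => ?_, fun j => ?_⟩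
    · simpa [D, mul_apply, sq] using congrFun (congrFun hX' i) i
    · simpa [D, mul_apply, sq] using congrFun (congrFun hX j) j
  obtain ⟨w, hw0, hw1, hw⟩ := exists_eq_sum_perm_of_mem_doublyStochastic hD
  have htr : trace (diagonal v * (X * diagonal k * Xᵀ)) = v ⬝ᵥ D *ᵥ k := by
    simp only [trace, diag_apply, diagonal_mul, dotProduct]
    refine Finset.sum_congr rfl fun i _ => ?_
    simp only [mul_apply (M := X * diagonal k), mul_diagonal, transpose_apply, mulVec,
      dotProduct, D, of_apply]
    congr 1
    exact Finset.sum_congr rfl fun j _ => by ring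
  have hanti : Antivary v k := hv.antivary hk
  rw [htr, ← hw, sum_mulVec, dotProduct_sum]
  calc ∑ i, v i * k i = ∑ σ, w σ * ∑ i, v i * k i := by rw [← Finset.sum_mul, hw1, one_mul]
    _ ≤ _ := by
      refine Finset.sum_le_sum fun σ _ => ?_
      rw [smul_mulVec, dotProduct_smul, smul_eq_mul, permMatrix_mulVec]
      exact mul_le_mul_of_nonneg_left hanti.sum_mul_le_sum_mul_comp_perm (hw0 σ)

theorem log_one_add_mul_div_le {s k l : ℝ} (hs : 0 ≤ s) (hk : 0 ≤ k) (hl : 0 ≤ l) :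
    Real.log (1 + s * (k / (1 + k))) ≤ Real.log (1 + s * (l / (1 + l))) +
      s / ((1 + (1 + s) * l) * (1 + l)) * (k - l) := by
  have hx : 0 < 1 + s * (k / (1 + k)) := by positivity
  have hy : 0 < 1 + s * (l / (1 + l)) := by positivity
  have h1 := Real.log_le_sub_one_of_pos (div_pos hx hy)
  rw [Real.log_div hx.ne' hy.ne'] at h1
  have h2 : s / ((1 + (1 + s) * l) * (1 + l)) * (k - l) -
      ((1 + s * (k / (1 + k))) / (1 + s * (l / (1 + l))) - 1) =
      s * (k - l) ^ 2 / ((1 + k) * (1 + l) * (1 + (1 + s) * l)) := by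
    have : 1 + s * (l / (1 + l)) = (1 + (1 + s) * l) / (1 + l) := by field_simp; ring
    rw [this]
    field_simp
    ring
  have h3 : 0 ≤ s * (k - l) ^ 2 / ((1 + k) * (1 + l) * (1 + (1 + s) * l)) := by positivity
  linarith

theorem waterfilling_stationarity {s v μ x : ℝ} (hs : 0 < s) (hv : 0 < v) (hμ : 0 < μ)
    (hx0 : 0 ≤ x)
    (hx : x = v / (2 * (1 + s)) *
      (-(2 + s) + Real.sqrt (s ^ 2 + 4 * (1 + s) * s / (2 * μ * v)))) :
    s / ((1 + (1 + s) * (x / v)) * (1 + x / v)) = 2 * μ * v := by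
  set r := Real.sqrt (s ^ 2 + 4 * (1 + s) * s / (2 * μ * v)) with hr
  have hr2 : r ^ 2 = s ^ 2 + 4 * (1 + s) * s / (2 * μ * v) := Real.sq_sqrt (by positivity)
  have hk : x / v = (r - (2 + s)) / (2 * (1 + s)) := by
    rw [hx]; field_simp; ring
  have hk0 : 0 ≤ x / v := div_nonneg hx0 hv.le
  rw [div_eq_iff (by positivity), hk]
  field_simp at hr2 ⊢
  linear_combination (-1 / 2) * hr2

theorem dotProduct_self_nonneg_real {n : ℕ} (x : Fin n → ℝ) : 0 ≤ x ⬝ᵥ x :=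
  Finset.sum_nonneg fun i _ => mul_self_nonneg (x i)

theorem det_one_add_diagonal_mul_pos {n : ℕ} {B : Matrix (Fin n) (Fin n) ℝ} (hB : B.PosSemidef)
    {s : Fin n → ℝ} (hs : ∀ i, 0 ≤ s i) : 0 < (1 + diagonal s * B).det := by
  have hss : diagonal s = diagonal (fun i => √(s i)) * diagonal (fun i => √(s i)) := by
    rw [diagonal_mul_diagonal]
    congr 1
    ext i
    exact (Real.mul_self_sqrt (hs i)).symm
  have h1 := hB.conjTranspose_mul_mul_same (diagonal fun i => √(s i))
  rw [conjTranspose_eq_transpose_of_trivial, diagonal_transpose] at h1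
  rw [hss, mul_assoc, det_one_add_mul_comm]
  exact (PosDef.one.add_posSemidef h1).det_pos

theorem dotProduct_transpose_mul_self_mulVec {m n : ℕ} (W : Matrix (Fin m) (Fin n) ℝ)
    (x : Fin n → ℝ) : x ⬝ᵥ (Wᵀ * W) *ᵥ x = W *ᵥ x ⬝ᵥ W *ᵥ x := by
  rw [← mulVec_mulVec, dotProduct_mulVec, vecMul_transpose]

theorem quadBoundOnCodim_transpose_mul_self {t q : ℕ} {W : Matrix (Fin t) (Fin q) ℝ}
    {X : Matrix (Fin t) (Fin t) ℝ} {k : Fin t → ℝ} (hk : Antitone k) (hX' : X * Xᵀ = 1)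
    (hW : W * Wᵀ = X * diagonal k * Xᵀ) (i : Fin t) :
    QuadBoundOnCodim (Wᵀ * W) i (k i) := by
  refine ⟨LinearMap.funLeft ℝ ℝ (Fin.castLE i.2.le) ∘ₗ (Xᵀ * W).mulVecLin, fun x hx => ?_⟩
  set y := W *ᵥ x with hy
  have hy0 : ∀ j : Fin t, j < i → (Xᵀ *ᵥ y) j = 0 := fun j hj => by
    have := congrFun hx ⟨j, hj⟩
    rw [hy, mulVec_mulVec]
    exact this
  have hyy : y ⬝ᵥ y = ∑ j, (Xᵀ *ᵥ y) j ^ 2 := by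
    have := dotProduct_conj_diagonal_mulVec X (fun _ => 1) y
    simpa [hX'] using this
  have h1 : Wᵀ *ᵥ y ⬝ᵥ Wᵀ *ᵥ y ≤ k i * (y ⬝ᵥ y) := by
    have h2 := dotProduct_transpose_mul_self_mulVec Wᵀ y
    rw [transpose_transpose, hW, dotProduct_conj_diagonal_mulVec] at h2
    rw [← h2, hyy, Finset.mul_sum]
    refine Finset.sum_le_sum fun j _ => ?_
    rcases lt_or_ge j i with h | h
    · simp [hy0 j h]
    · exact mul_le_mul_of_nonneg_right (hk h) (sq_nonneg _)
  have h3 : x ⬝ᵥ Wᵀ *ᵥ y = y ⬝ᵥ y := by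
    rw [dotProduct_mulVec, vecMul_transpose]
  rw [dotProduct_transpose_mul_self_mulVec]
  have h4 : 0 ≤ y ⬝ᵥ y := dotProduct_self_nonneg_real y
  rcases h4.eq_or_lt with h5 | h5
  · rw [← hy, ← h5]
    have h6 : 0 ≤ k i := by
      have h7 := dotProduct_transpose_mul_self_mulVec Wᵀ (X *ᵥ Pi.single i 1)
      rw [transpose_transpose, hW, dotProduct_conj_diagonal_mulVec, mulVec_mulVec,
        mul_eq_one_comm.1 hX', one_mulVec] at h7
      have h8 := dotProduct_self_nonneg_real (Wᵀ *ᵥ X *ᵥ Pi.single i 1)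
      rw [← h7] at h8
      simpa [Pi.single_apply] using h8
    exact mul_nonneg h6 (dotProduct_self_nonneg_real x)
  · have h6 : (x ⬝ᵥ Wᵀ *ᵥ y) ^ 2 ≤ (x ⬝ᵥ x) * (Wᵀ *ᵥ y ⬝ᵥ Wᵀ *ᵥ y) := by
      have := Finset.sum_mul_sq_le_sq_mul_sq Finset.univ x (Wᵀ *ᵥ y)
      simpa [dotProduct, sq] using this
    rw [h3] at h6
    have h7 : (x ⬝ᵥ x) * (Wᵀ *ᵥ y ⬝ᵥ Wᵀ *ᵥ y) ≤ (x ⬝ᵥ x) * (k i * (y ⬝ᵥ y)) :=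
      mul_le_mul_of_nonneg_left h1 (dotProduct_self_nonneg_real x)
    refine le_of_mul_le_mul_right ?_ h5
    rw [← hy]
    linarith

theorem quadBoundOnCodim_transpose_mul_self_zero {t q i : ℕ} (W : Matrix (Fin t) (Fin q) ℝ)
    (hi : t ≤ i) : QuadBoundOnCodim (Wᵀ * W) i 0 := by
  let E : Matrix (Fin i) (Fin t) ℝ :=
    (1 : Matrix (Fin i) (Fin i) ℝ).submatrix id (Fin.castLE hi)
  refine ⟨(E * W).mulVecLin, fun x hx => ?_⟩
  have hE : Eᵀ * E = 1 := submatrix_one_transpose_mul_self (Fin.castLE_injective hi)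
  have hWx : W *ᵥ x = 0 := by
    have h1 : (E * W) *ᵥ x = 0 := hx
    rw [← Matrix.one_mul W, ← hE, Matrix.mul_assoc, ← mulVec_mulVec, h1, mulVec_zero]
  rw [dotProduct_transpose_mul_self_mulVec, hWx]
  simp

theorem transpose_mul_inv_one_add_mul {t q : ℕ} (W : Matrix (Fin t) (Fin q) ℝ) :
    Wᵀ * (1 + W * Wᵀ)⁻¹ * W = Wᵀ * W * (1 + (1 : ℝ) • (Wᵀ * W))⁻¹ := by
  rw [one_smul]
  have h1 : IsUnit (1 + W * Wᵀ).det := by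
    have := (posSemidef_self_mul_conjTranspose W).posDef_one_add_smul zero_le_one
    simpa using (isUnit_iff_isUnit_det _).1 this.isUnit
  have h2 : IsUnit (1 + Wᵀ * W).det := by
    have := (posSemidef_conjTranspose_mul_self W).posDef_one_add_smul zero_le_one
    simpa using (isUnit_iff_isUnit_det _).1 this.isUnit
  have h3 : W * (1 + Wᵀ * W) = (1 + W * Wᵀ) * W := by
    rw [Matrix.mul_add, Matrix.add_mul, Matrix.mul_one, Matrix.one_mul, Matrix.mul_assoc]
  have h4 : (1 + W * Wᵀ)⁻¹ * W = W * (1 + Wᵀ * W)⁻¹ := by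
    calc (1 + W * Wᵀ)⁻¹ * W = (1 + W * Wᵀ)⁻¹ * (W * (1 + Wᵀ * W)) * (1 + Wᵀ * W)⁻¹ := by
          rw [Matrix.mul_assoc, Matrix.mul_assoc, mul_nonsing_inv _ h2, Matrix.mul_one]
      _ = W * (1 + Wᵀ * W)⁻¹ := by
          rw [h3, ← Matrix.mul_assoc, nonsing_inv_mul _ h1, Matrix.one_mul]
  rw [Matrix.mul_assoc, h4, Matrix.mul_assoc]

theorem posSemidef_transpose_mul_inv_one_add_mul {t q : ℕ} (W : Matrix (Fin t) (Fin q) ℝ) :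
    (Wᵀ * (1 + W * Wᵀ)⁻¹ * W).PosSemidef := by
  rw [transpose_mul_inv_one_add_mul]
  exact (posSemidef_conjTranspose_mul_self W).mul_inv_one_add_smul zero_le_one

theorem det_one_add_diagonal_mul_channel_le_prod {t q : ℕ} (htq : t ≤ q)
    {W : Matrix (Fin t) (Fin q) ℝ} {X : Matrix (Fin t) (Fin t) ℝ} {k : Fin t → ℝ}
    {s : Fin q → ℝ} (hk : Antitone k) (hk0 : ∀ i, 0 ≤ k i) (hX' : X * Xᵀ = 1)
    (hW : W * Wᵀ = X * diagonal k * Xᵀ) (hs : Antitone s) (hs0 : ∀ j, 0 ≤ s j) :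
    (1 + diagonal s * (Wᵀ * (1 + W * Wᵀ)⁻¹ * W)).det ≤
      ∏ i, (1 + s (Fin.castLE htq i) * (k i / (1 + k i))) := by
  let b : Fin q → ℝ := fun j =>
    if h : (j : ℕ) < t then k ⟨j, h⟩ / (1 + k ⟨j, h⟩) else 0
  have hWW : (Wᵀ * W).PosSemidef := posSemidef_conjTranspose_mul_self W
  have h1 := det_one_add_diagonal_mul_le_prod
    (posSemidef_transpose_mul_inv_one_add_mul W) (b := b) hs hs0 ?_ ?_
  · refine h1.trans_eq (Eq.symm ?_)
    refine Fintype.prod_of_injective (Fin.castLE htq) (Fin.castLE_injective htq) _ _ ?_ ?_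
    · intro j hj
      have : ¬ (j : ℕ) < t := fun h => hj ⟨⟨j, h⟩, rfl⟩
      simp [b, this]
    · intro i
      simp [b]
  · intro j
    dsimp only [b]
    split_ifs with h
    · have := hk0 ⟨j, h⟩
      positivity
    · rfl
  · intro j
    rw [transpose_mul_inv_one_add_mul]
    dsimp only [b]
    split_ifs with h
    · simpa using (quadBoundOnCodim_transpose_mul_self hk hX' hW ⟨j, h⟩).mul_inv_one_add_smul
        hWW zero_le_one (hk0 _)
    · simpa using (quadBoundOnCodim_transpose_mul_self_zero W (not_lt.1 h)).mul_inv_one_add_smul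
        hWW zero_le_one le_rfl

theorem det_one_add_diagonal_mul_channel_eq_prod {t q : ℕ} (htq : t ≤ q) (s : Fin q → ℝ)
    (w : Fin t → ℝ) {J : Matrix (Fin q) (Fin t) ℝ}
    (hJ : J = (1 : Matrix (Fin q) (Fin q) ℝ).submatrix id (Fin.castLE htq))
    {W : Matrix (Fin t) (Fin q) ℝ} (hW : W = diagonal w * Jᵀ) :
    (1 + diagonal s * (Wᵀ * (1 + W * Wᵀ)⁻¹ * W)).det =
      ∏ i, (1 + s (Fin.castLE htq i) * (w i ^ 2 / (1 + w i ^ 2))) := by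
  have hJJ : Jᵀ * J = 1 := by
    rw [hJ, submatrix_one_transpose_mul_self (Fin.castLE_injective htq)]
  have hJs : Jᵀ * (diagonal s * J) = diagonal (s ∘ Fin.castLE htq) := by
    rw [← Matrix.mul_assoc, hJ, submatrix_one_conj,
      submatrix_diagonal _ _ (Fin.castLE_injective htq)]
  have hpos : ∀ i, 1 + w i ^ 2 ≠ 0 := fun i => by positivity
  have hWW : 1 + W * Wᵀ = diagonal fun i => 1 + w i ^ 2 := by
    rw [hW, transpose_mul, transpose_transpose, diagonal_transpose, Matrix.mul_assoc, ← Matrix.mul_assoc Jᵀ,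
      hJJ, Matrix.one_mul, diagonal_mul_diagonal, ← diagonal_one, diagonal_add]
    simp [sq]
  have hinv : (1 + W * Wᵀ)⁻¹ = diagonal fun i => (1 + w i ^ 2)⁻¹ := by
    refine inv_eq_right_inv ?_
    rw [hWW, diagonal_mul_diagonal, ← diagonal_one]
    congr 1
    ext i
    exact mul_inv_cancel₀ (hpos i)
  rw [hinv, hW, transpose_mul, transpose_transpose, diagonal_transpose]
  have : diagonal s * (J * diagonal w * (diagonal fun i => (1 + w i ^ 2)⁻¹) * (diagonal w * Jᵀ)) =
      (diagonal s * J * (diagonal fun i => w i ^ 2 / (1 + w i ^ 2))) * Jᵀ := by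
    have h1 : diagonal (fun i => w i ^ 2 / (1 + w i ^ 2)) =
        diagonal w * ((diagonal fun i => (1 + w i ^ 2)⁻¹) * diagonal w) := by
      rw [diagonal_mul_diagonal, diagonal_mul_diagonal]
      congr 1
      ext i
      ring
    rw [h1]
    simp only [Matrix.mul_assoc]
  rw [this, det_one_add_mul_comm, ← Matrix.mul_assoc, hJs, diagonal_mul_diagonal, ← diagonal_one,
    diagonal_add, det_diagonal]
  rfl

theorem infoGain_rotate {p q t : ℕ} {Qθx : Matrix (Fin p) (Fin p) ℝ}
    {M : Matrix (Fin q) (Fin p) ℝ} {Qv Uv : Matrix (Fin t) (Fin t) ℝ}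
    (hUv : Uvᵀ * Uv = 1) {d : Fin t → ℝ} (hd : ∀ i, 0 < d i)
    (hQv : Qv = Uv * (diagonal d * diagonal d) * Uvᵀ)
    {Uξ : Matrix (Fin q) (Fin q) ℝ} (hUξ : Uξᵀ * Uξ = 1) {σξ : Fin q → ℝ}
    (hM : M * Qθx * Mᵀ = Uξ * diagonal σξ * Uξᵀ) (W : Matrix (Fin t) (Fin q) ℝ) :
    infoGain Qθx M 1 Qv (Uv * (diagonal d * W) * Uξᵀ) =
      1 / 2 * Real.log (1 + diagonal σξ * (Wᵀ * (1 + W * Wᵀ)⁻¹ * W)).det := by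
  have hUvinv : Uv⁻¹ = Uvᵀ := inv_eq_left_inv hUv
  have hUvinv' : Uvᵀ⁻¹ = Uv := inv_eq_right_inv hUv
  have hUvc : ∀ A : Matrix (Fin t) (Fin q) ℝ, Uvᵀ * (Uv * A) = A := fun A => by
    rw [← Matrix.mul_assoc, hUv, Matrix.one_mul]
  have hUvc' : ∀ A : Matrix (Fin t) (Fin t) ℝ, Uvᵀ * (Uv * A) = A := fun A => by
    rw [← Matrix.mul_assoc, hUv, Matrix.one_mul]
  have hUξc : ∀ A : Matrix (Fin q) (Fin t) ℝ, Uξᵀ * (Uξ * A) = A := fun A => by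
    rw [← Matrix.mul_assoc, hUξ, Matrix.one_mul]
  have hD : IsUnit (diagonal d).det := by
    rw [det_diagonal]
    exact (Finset.prod_pos fun i _ => hd i).ne'.isUnit
  have hZ : Uv * (diagonal d * W) * Uξᵀ * (1 : Matrix (Fin q) (Fin q) ℝ) * (Uv * (diagonal d * W) * Uξᵀ)ᵀ + Qv =
      Uv * (diagonal d * (1 + W * Wᵀ) * diagonal d) * Uvᵀ := by
    rw [hQv]
    simp only [transpose_mul, transpose_transpose, diagonal_transpose, Matrix.mul_one, Matrix.mul_add, Matrix.add_mul,
      Matrix.mul_assoc, hUξc]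
    rw [add_comm]
  have hR : (Uv * (diagonal d * W) * Uξᵀ)ᵀ *
      (Uv * (diagonal d * (1 + W * Wᵀ) * diagonal d) * Uvᵀ)⁻¹ *
      (Uv * (diagonal d * W) * Uξᵀ) = Uξ * (Wᵀ * (1 + W * Wᵀ)⁻¹ * W) * Uξᵀ := by
    simp only [Matrix.mul_inv_rev, hUvinv, hUvinv', transpose_mul, transpose_transpose,
      diagonal_transpose, Matrix.mul_assoc, hUvc, hUvc', nonsing_inv_mul_cancel_left _ _ hD,
      mul_nonsing_inv_cancel_left _ _ hD]
  have hdet : ∀ Z : Matrix (Fin q) (Fin q) ℝ,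
      (1 + Mᵀ * (Uξ * Z * Uξᵀ) * M * Qθx).det = (1 + diagonal σξ * Z).det := fun Z => by
    rw [Matrix.mul_assoc, Matrix.mul_assoc, det_one_add_mul_comm, Matrix.mul_assoc, hM]
    have : Uξ * Z * Uξᵀ * (Uξ * diagonal σξ * Uξᵀ) = Uξ * (Z * diagonal σξ * Uξᵀ) := by
      simp only [Matrix.mul_assoc]
      rw [← Matrix.mul_assoc Uξᵀ Uξ, hUξ, Matrix.one_mul]
    rw [this, det_one_add_mul_comm, Matrix.mul_assoc, hUξ, Matrix.mul_one, det_one_add_mul_comm]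
  unfold infoGain
  rw [hZ, ← hdet, ← hR]
  simp only [Matrix.mul_assoc]

theorem trace_rotate {q t : ℕ} {Uv : Matrix (Fin t) (Fin t) ℝ} (hUv : Uvᵀ * Uv = 1)
    {Uξ : Matrix (Fin q) (Fin q) ℝ} (hUξ : Uξᵀ * Uξ = 1) (H : Matrix (Fin t) (Fin q) ℝ) :
    trace ((Uv * H * Uξᵀ) * (Uv * H * Uξᵀ)ᵀ) = trace (H * Hᵀ) := by
  have : (Uv * H * Uξᵀ) * (Uv * H * Uξᵀ)ᵀ = Uv * (H * Hᵀ * Uvᵀ) := by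
    simp only [transpose_mul, transpose_transpose, Matrix.mul_assoc]
    rw [← Matrix.mul_assoc Uξᵀ Uξ, hUξ, Matrix.one_mul]
  rw [this, trace_mul_comm, Matrix.mul_assoc, hUv, Matrix.mul_one]

/-- Theorem 1: with `Q_{φφ|θ} = I_q`, the matrix
`G* = U_v Λ* U_ξᵀ`, with `Λ*` determined by mercury/waterfilling, meets the
power constraint with equality and maximizes the information gain. -/
theorem optimal_channel_matrix (p q t : ℕ) (hp : 0 < p) (hq : 0 < q) (ht : 0 < t)
    (htq : t ≤ q)
    (Qθx : Matrix (Fin p) (Fin p) ℝ) (hQθx : Qθx.PosDef)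
    (M : Matrix (Fin q) (Fin p) ℝ)
    (Qv : Matrix (Fin t) (Fin t) ℝ) (hQv : Qv.PosDef)
    -- eigendecomposition of the noise covariance
    (Uv : Matrix (Fin t) (Fin t) ℝ) (hUv : Uvᵀ * Uv = 1) (hUv' : Uv * Uvᵀ = 1)
    (σv : Fin t → ℝ)
    (hQvdecomp : Qv = Uv * diagonal σv * Uvᵀ)
    (hσv_pos : ∀ i, 0 < σv i) (hσv_mono : StrictMono σv)
    -- eigendecomposition of `M Q_{θθ|x} Mᵀ`
    (Uξ : Matrix (Fin q) (Fin q) ℝ) (hUξ : Uξᵀ * Uξ = 1) (hUξ' : Uξ * Uξᵀ = 1)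
    (σξ : Fin q → ℝ)
    (hMdecomp : M * Qθx * Mᵀ = Uξ * diagonal σξ * Uξᵀ)
    (ρ : ℕ) (hρ1 : 1 ≤ ρ) (hρt : ρ ≤ t)
    (hσξ_pos : ∀ j : Fin q, (j : ℕ) < ρ → 0 < σξ j)
    (hσξ_anti : ∀ i j : Fin q, i < j → (j : ℕ) < ρ → σξ j < σξ i)
    (hσξ_zero : ∀ j : Fin q, ρ ≤ (j : ℕ) → σξ j = 0)
    -- mercury/waterfilling parameters
    (P : ℝ) (hP : 0 < P)
    (μ : ℝ) (hμ : 0 < μ)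
    (κ : ℕ) (hκ1 : 1 ≤ κ) (hκρ : κ ≤ ρ)
    (hactive : ∀ i : Fin t, (i : ℕ) < κ →
      2 * μ * σv i < σξ (Fin.castLE htq i))
    (hinactive : ∀ i : Fin t, κ ≤ (i : ℕ) → (i : ℕ) < ρ →
      σξ (Fin.castLE htq i) ≤ 2 * μ * σv i)
    (lam : Fin t → ℝ)
    (hlam : ∀ i : Fin t, (i : ℕ) < κ →
      (lam i) ^ 2 = σv i / (2 * (1 + σξ (Fin.castLE htq i))) *
        (-(2 + σξ (Fin.castLE htq i)) +
          Real.sqrt ((σξ (Fin.castLE htq i)) ^ 2 +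
            4 * (1 + σξ (Fin.castLE htq i)) * σξ (Fin.castLE htq i) /
              (2 * μ * σv i))))
    (hlam0 : ∀ i : Fin t, κ ≤ (i : ℕ) → lam i = 0)
    (hsum : ∑ i ∈ Finset.univ.filter (fun i : Fin t => (i : ℕ) < κ),
      (lam i) ^ 2 = P) :
    trace ((Uv * (Matrix.of fun (i : Fin t) (j : Fin q) =>
          if (j : ℕ) = (i : ℕ) then lam i else 0) * Uξᵀ) *
        (Uv * (Matrix.of fun (i : Fin t) (j : Fin q) =>
          if (j : ℕ) = (i : ℕ) then lam i else 0) * Uξᵀ)ᵀ) = P ∧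
      ∀ G : Matrix (Fin t) (Fin q) ℝ, trace (G * Gᵀ) ≤ P →
        infoGain Qθx M (1 : Matrix (Fin q) (Fin q) ℝ) Qv G ≤
          infoGain Qθx M (1 : Matrix (Fin q) (Fin q) ℝ) Qv
            (Uv * (Matrix.of fun (i : Fin t) (j : Fin q) =>
              if (j : ℕ) = (i : ℕ) then lam i else 0) * Uξᵀ) := by
  obtain ⟨d, hd⟩ : ∃ d : Fin t → ℝ, d = fun i => Real.sqrt (σv i) := ⟨_, rfl⟩
  have hd0 : ∀ i, 0 < d i := fun i => by rw [hd]; exact Real.sqrt_pos.2 (hσv_pos i)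
  have hd2 : ∀ i, d i ^ 2 = σv i := fun i => by rw [hd]; exact Real.sq_sqrt (hσv_pos i).le
  have hdd : diagonal d * diagonal d = diagonal σv := by
    rw [diagonal_mul_diagonal]
    congr 1
    ext i
    rw [← sq, hd2]
  have hdi : diagonal d * diagonal (fun i => (d i)⁻¹) = 1 := by
    rw [diagonal_mul_diagonal, ← diagonal_one]
    congr 1
    ext i
    exact mul_inv_cancel₀ (hd0 i).ne'
  have hs0 : ∀ j, 0 ≤ σξ j := fun j => by
    rcases lt_or_ge (j : ℕ) ρ with h | h
    · exact (hσξ_pos j h).le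
    · exact (hσξ_zero j h).ge
  have hs : Antitone σξ := fun i j hij => by
    rcases hij.eq_or_lt with rfl | hij
    · exact le_rfl
    rcases lt_or_ge (j : ℕ) ρ with h | h
    · exact (hσξ_anti i j hij h).le
    · exact (hσξ_zero j h).trans_le (hs0 i)
  obtain ⟨J, hJ⟩ : ∃ J, J = (1 : Matrix (Fin q) (Fin q) ℝ).submatrix id (Fin.castLE htq) :=
    ⟨_, rfl⟩
  have hJJ : Jᵀ * J = 1 := by rw [hJ, submatrix_one_transpose_mul_self (Fin.castLE_injective htq)]
  have hΛ : (Matrix.of fun (i : Fin t) (j : Fin q) => if (j : ℕ) = (i : ℕ) then lam i else 0) =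
      diagonal lam * Jᵀ := by
    ext i j
    simp [hJ, one_apply, Fin.ext_iff, eq_comm]
  have hsum' : ∑ i, lam i ^ 2 = P := by
    rw [← hsum, Finset.sum_filter]
    refine Finset.sum_congr rfl fun i _ => ?_
    split_ifs with h
    · rfl
    · rw [hlam0 i (not_lt.1 h), sq, zero_mul]
  rw [hΛ]
  refine ⟨?_, fun G hG => ?_⟩
  · rw [trace_rotate hUv hUξ, transpose_mul, transpose_transpose, diagonal_transpose, Matrix.mul_assoc,
      ← Matrix.mul_assoc Jᵀ, hJJ, Matrix.one_mul, diagonal_mul_diagonal, trace_diagonal, ← hsum']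
    exact Finset.sum_congr rfl fun i _ => (sq _).symm
  obtain ⟨W, hW⟩ : ∃ W, W = diagonal (fun i => (d i)⁻¹) * (Uvᵀ * G * Uξ) := ⟨_, rfl⟩
  have hGW : G = Uv * (diagonal d * W) * Uξᵀ := by
    rw [hW, ← Matrix.mul_assoc (diagonal d), hdi, Matrix.one_mul, ← Matrix.mul_assoc, ← Matrix.mul_assoc, hUv', Matrix.one_mul, Matrix.mul_assoc, hUξ',
      Matrix.mul_one]
  obtain ⟨w, hw⟩ : ∃ w : Fin t → ℝ, w = fun i => (d i)⁻¹ * lam i := ⟨_, rfl⟩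
  have hlamw : diagonal lam * Jᵀ = diagonal d * (diagonal w * Jᵀ) := by
    rw [← Matrix.mul_assoc, diagonal_mul_diagonal]
    congr 2
    ext i
    rw [hw, mul_inv_cancel_left₀ (hd0 i).ne']
  have hw2 : ∀ i, w i ^ 2 = lam i ^ 2 / σv i := fun i => by
    rw [hw, mul_pow, inv_pow, hd2]
    ring
  have hWps : (W * Wᵀ).PosSemidef := posSemidef_self_mul_conjTranspose W
  obtain ⟨X, k, hk, hX, hX', hWX⟩ := hWps.isHermitian.exists_antitone_diagonalization
  have hk0 : ∀ i, 0 ≤ k i := by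
    have h1 := hWps.conjTranspose_mul_mul_same X
    rw [conjTranspose_eq_transpose_of_trivial, hWX, Matrix.mul_assoc, Matrix.mul_assoc, Matrix.mul_assoc, hX, Matrix.mul_one,
      ← Matrix.mul_assoc, hX, Matrix.one_mul] at h1
    exact posSemidef_diagonal_iff.1 h1
  have hpow : ∑ i, σv i * k i ≤ P := by
    refine (sum_mul_le_trace_diagonal_mul_conj hσv_mono.monotone hk hX hX').trans ?_
    rw [hGW, trace_rotate hUv hUξ, transpose_mul, diagonal_transpose, Matrix.mul_assoc, trace_mul_comm,
      Matrix.mul_assoc, Matrix.mul_assoc, hdd, ← Matrix.mul_assoc, trace_mul_comm, hWX] at hG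
    exact hG
  have hQv' : Qv = Uv * (diagonal d * diagonal d) * Uvᵀ := by rw [hdd, hQvdecomp]
  rw [hlamw, hGW, infoGain_rotate hUv hd0 hQv' hUξ hMdecomp,
    infoGain_rotate hUv hd0 hQv' hUξ hMdecomp,
    det_one_add_diagonal_mul_channel_eq_prod htq σξ w hJ rfl]
  refine mul_le_mul_of_nonneg_left ?_ (by norm_num)
  have hdetpos : 0 < (1 + diagonal σξ * (Wᵀ * (1 + W * Wᵀ)⁻¹ * W)).det :=
    det_one_add_diagonal_mul_pos (posSemidef_transpose_mul_inv_one_add_mul W) hs0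
  have hfac : ∀ (i : Fin t) {a : ℝ}, 0 ≤ a → 1 + σξ (Fin.castLE htq i) * (a / (1 + a)) ≠ 0 :=
    fun i a ha => by
      have := hs0 (Fin.castLE htq i)
      positivity
  refine (Real.log_le_log hdetpos
    (det_one_add_diagonal_mul_channel_le_prod htq hk hk0 hX' hWX hs hs0)).trans ?_
  rw [Real.log_prod fun i _ => hfac i (hk0 i), Real.log_prod fun i _ => hfac i (sq_nonneg _)]
  have hterm : ∀ i, Real.log (1 + σξ (Fin.castLE htq i) * (k i / (1 + k i))) ≤
      Real.log (1 + σξ (Fin.castLE htq i) * (w i ^ 2 / (1 + w i ^ 2))) +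
        2 * μ * (σv i * k i - lam i ^ 2) := fun i => by
    have hv := hσv_pos i
    refine (log_one_add_mul_div_le (hs0 _) (hk0 i) (sq_nonneg (w i))).trans
      (add_le_add_right ?_ _)
    rcases lt_or_ge (i : ℕ) κ with h | h
    · rw [hw2, waterfilling_stationarity (hσξ_pos _ (h.trans_le hκρ)) hv hμ (sq_nonneg _)
        (hlam i h)]
      refine le_of_eq ?_
      field_simp
    · have h1 : σξ (Fin.castLE htq i) ≤ 2 * μ * σv i := by
        rcases lt_or_ge (i : ℕ) ρ with h' | h'
        · exact hinactive i h h'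
        · rw [hσξ_zero _ h']
          positivity
      have h2 := mul_le_mul_of_nonneg_right h1 (hk0 i)
      rw [hw2, hlam0 i h]
      simpa [mul_assoc] using h2
  refine (Finset.sum_le_sum fun i _ => hterm i).trans ?_
  rw [Finset.sum_add_distrib, ← Finset.mul_sum, Finset.sum_sub_distrib, hsum']
  have : 2 * μ * (∑ i, σv i * k i - P) ≤ 0 :=
    mul_nonpos_of_nonneg_of_nonpos (by positivity) (sub_nonpos.2 hpow)
  linarith
end

section
/- (Mercury/waterfilling optimality for the scalar subchannel problem) Let t ≥ 1, let a_1 > a_2 > … > a_t ≥ 0 and 0 < b_1 < b_2 < … < b_t be real numbers, and let P > 0. Suppose μ > 0 and κ ∈ {1, …, t} satisfy: a_i > 2μ b_i for all i ≤ κ, a_i ≤ 2μ b_i for all i > κ, and ∑_{i=1}^{κ} λ*_i² = P, where for i ≤ κ, λ*_i² = (b_i / (2(1+a_i)))·( −(2+a_i) + √( (2+a_i)² − 4(1+a_i)(1 − a_i/(2μ b_i)) ) ), and λ*_i = 0 for i > κ. Then (λ*_1, …, λ*_t) maximizes the function F(λ_1, …, λ_t) = (1/2)·∑_{i=1}^{t}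 log( 1 + a_i λ_i²/(λ_i² + b_i) ) over all real vectors (λ_1, …, λ_t) with ∑_{i=1}^{t} λ_i² ≤ P. -/
/-- Tangent-line bound for the concave map `p ↦ log (1 + a * p / (p + b))`. -/
theorem log_one_add_mul_div_le_tangent {a b p q : ℝ} (ha : 0 ≤ a) (hb : 0 < b)
    (hp : 0 ≤ p) (hq : 0 ≤ q) :
    Real.log (1 + a * p / (p + b)) ≤ Real.log (1 + a * q / (q + b)) +
      a * b / ((q + b) * ((1 + a) * q + b)) * (p - q) := by
  have hpb : 0 < p + b := by positivity
  have hqb : 0 < q + b := by positivity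
  have hqc : 0 < (1 + a) * q + b := by positivity
  have hgp : 0 < 1 + a * p / (p + b) := by positivity
  have hgq : 0 < 1 + a * q / (q + b) := by positivity
  have hlog := Real.log_le_sub_one_of_pos (div_pos hgp hgq)
  rw [Real.log_div hgp.ne' hgq.ne'] at hlog
  have hgap : a * b / ((q + b) * ((1 + a) * q + b)) * (p - q) -
      ((1 + a * p / (p + b)) / (1 + a * q / (q + b)) - 1) =
      a * b * (p - q) ^ 2 / ((p + b) * (q + b) * ((1 + a) * q + b)) := by
    have hq_eq : 1 + a * q / (q + b) = ((1 + a) * q + b) / (q + b) := by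
      field_simp
      ring
    rw [hq_eq]
    field_simp
    ring
  have hnonneg : 0 ≤ a * b * (p - q) ^ 2 / ((p + b) * (q + b) * ((1 + a) * q + b)) := by
    positivity
  linarith

/-- The mercury/waterfilling power is a root of the stationarity equation of its subchannel. -/
theorem stationarity_of_mercury_waterfilling {a b μ q : ℝ} (hb : 0 < b) (hμ : 0 < μ)
    (hab : 2 * μ * b < a)
    (hq : q = b / (2 * (1 + a)) *
      (-(2 + a) + Real.sqrt ((2 + a) ^ 2 - 4 * (1 + a) * (1 - a / (2 * μ * b))))) :
    2 * μ * ((q + b) * ((1 + a) * q + b)) = a * b := by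
  have hμb : 0 < 2 * μ * b := by positivity
  have ha : 0 < 1 + a := by linarith
  have hratio : 1 < a / (2 * μ * b) := (one_lt_div hμb).2 hab
  have hsq := Real.sq_sqrt (show 0 ≤ (2 + a) ^ 2 - 4 * (1 + a) * (1 - a / (2 * μ * b)) by
    nlinarith [sq_nonneg (2 + a)])
  set s := Real.sqrt ((2 + a) ^ 2 - 4 * (1 + a) * (1 - a / (2 * μ * b)))
  have hs : s = 2 * (1 + a) * q / b + (2 + a) := by
    rw [hq]
    field_simp
    ring
  rw [hs] at hsq
  field_simp at hsq
  have hfactor : (1 + a) * (2 * μ * ((q + b) * ((1 + a) * q + b)) - a * b) = 0 := by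
    linarith
  rcases mul_eq_zero.1 hfactor with h | h <;> linarith


/-- mercury/waterfilling optimality for the scalar subchannel
power-allocation problem. -/
theorem mercury_waterfilling_optimal (t : ℕ) (ht : 1 ≤ t)
    (a b : Fin t → ℝ)
    (ha_anti : ∀ i j : Fin t, i < j → a j < a i) (ha_nonneg : ∀ i, 0 ≤ a i)
    (hb_mono : ∀ i j : Fin t, i < j → b i < b j) (hb_pos : ∀ i, 0 < b i)
    (P : ℝ) (hP : 0 < P)
    (μ : ℝ) (hμ : 0 < μ)
    (κ : ℕ) (hκ1 : 1 ≤ κ) (hκt : κ ≤ t)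
    (hactive : ∀ i : Fin t, (i : ℕ) < κ → 2 * μ * b i < a i)
    (hinactive : ∀ i : Fin t, κ ≤ (i : ℕ) → a i ≤ 2 * μ * b i)
    (lam : Fin t → ℝ)
    (hlam : ∀ i : Fin t, (i : ℕ) < κ →
      (lam i) ^ 2 = b i / (2 * (1 + a i)) *
        (-(2 + a i) +
          Real.sqrt ((2 + a i) ^ 2 - 4 * (1 + a i) * (1 - a i / (2 * μ * b i)))))
    (hlam0 : ∀ i : Fin t, κ ≤ (i : ℕ) → lam i = 0)
    (hsum : ∑ i ∈ Finset.univ.filter (fun i : Fin t => (i : ℕ) < κ),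
      (lam i) ^ 2 = P) :
    ∀ x : Fin t → ℝ, ∑ i, (x i) ^ 2 ≤ P →
      (1 / 2 : ℝ) * ∑ i, Real.log (1 + a i * (x i) ^ 2 / ((x i) ^ 2 + b i)) ≤
        (1 / 2 : ℝ) * ∑ i, Real.log (1 + a i * (lam i) ^ 2 / ((lam i) ^ 2 + b i)) := by
  intro x hx
  have htotal : ∑ i, (lam i) ^ 2 = P := by
    rw [← hsum, Finset.sum_filter]
    refine Finset.sum_congr rfl fun i _ => ?_
    split_ifs with h
    · rfl
    · simp [hlam0 i (not_lt.1 h)]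
  have hbound : ∀ i, Real.log (1 + a i * (x i) ^ 2 / ((x i) ^ 2 + b i)) ≤
      Real.log (1 + a i * (lam i) ^ 2 / ((lam i) ^ 2 + b i)) +
        2 * μ * ((x i) ^ 2 - (lam i) ^ 2) := by
    intro i
    have hb := hb_pos i
    have ha := ha_nonneg i
    refine (log_one_add_mul_div_le_tangent ha hb (sq_nonneg (x i))
      (sq_nonneg (lam i))).trans (add_le_add_right ?_ _)
    rcases lt_or_ge (i : ℕ) κ with h | h
    · have hstat := stationarity_of_mercury_waterfilling hb hμ (hactive i h) (hlam i h)
      rw [← hstat, mul_div_cancel_right₀ _ (by positivity)]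
    · rw [hlam0 i h]
      have hslope : a i * b i / ((0 ^ 2 + b i) * ((1 + a i) * 0 ^ 2 + b i)) ≤ 2 * μ := by
        rw [div_le_iff₀ (by positivity)]
        nlinarith [mul_le_mul_of_nonneg_right (hinactive i h) hb.le]
      exact mul_le_mul_of_nonneg_right hslope (by nlinarith [sq_nonneg (x i)])
  have hsum_le := Finset.sum_le_sum fun i (_ : i ∈ Finset.univ) => hbound i
  rw [Finset.sum_add_distrib, ← Finset.mul_sum, Finset.sum_sub_distrib, htotal] at hsum_le
  have hslack : 2 * μ * (∑ i, (x i) ^ 2 - P) ≤ 0 :=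
    mul_nonpos_of_nonneg_of_nonpos (by positivity) (by linarith)
  linarith
end

section
/- (Gradient of the information gain) Assume additionally that Q_{φφ|θ} is positive definite. Set B = Q_{φφ|θ}⁻¹ M Q_{θθ|x} Mᵀ (I_q + Q_{φφ|θ}⁻¹ M Q_{θθ|x} Mᵀ)⁻¹ Q_{φφ|θ}⁻¹. Then for every t×q real matrix G, the matrix (Q_{φφ|θ}⁻¹ + Gᵀ Q_{vv}⁻¹ G) − B is invertible, the function G ↦ D(G) is (Fréchet) differentiable at G, and its derivative in direction H (a t×q real matrix) equals tr(Hᵀ ∇D), where ∇D = Q_{vv}⁻¹ G [ (Q_{φφ|θ}⁻¹ + Gᵀ Q_{vv}⁻¹ G) − B ]⁻¹ B (Q_{φφ|θ}⁻¹ + Gᵀ Q_{vv}⁻¹ G)⁻¹. -/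
open Matrix

attribute [local instance] Matrix.normedAddCommGroup Matrix.normedSpace

/-- **Jacobi's formula**: the Fréchet derivative of the determinant. -/
theorem Matrix.exists_hasFDerivAt_det {n : ℕ} (X : Matrix (Fin n) (Fin n) ℝ) :
    ∃ f : Matrix (Fin n) (Fin n) ℝ →L[ℝ] ℝ,
      HasFDerivAt (fun Y : Matrix (Fin n) (Fin n) ℝ => Y.det) f X ∧
        ∀ E, f E = trace (X.adjugate * E) := by
  let F : ContinuousMultilinearMap ℝ (fun _ : Fin n => Fin n → ℝ) ℝ :=
    ⟨(detRowAlternating (n := Fin n) (R := ℝ)).toMultilinearMap,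
      Continuous.matrix_det (A := fun Y : Matrix (Fin n) (Fin n) ℝ => Y) continuous_id⟩
  refine ⟨F.linearDeriv X, F.hasFDerivAt X, fun E => ?_⟩
  have h (i : Fin n) : F (Function.update X i (E i)) = (E * X.adjugate) i i := by
    have h_det : F (Function.update X i (E i)) = (X.updateRow i (E i)).det := rfl
    rw [h_det, ← cramer_transpose_apply, cramer_eq_adjugate_mulVec, ← adjugate_transpose,
      mulVec_transpose]
    rfl
  rw [trace_mul_comm]
  exact (F.linearDeriv_apply X E).trans (Finset.sum_congr rfl fun i _ => h i)

/-- The Fréchet derivative of the log-determinant at an invertible matrix. -/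
theorem Matrix.exists_hasFDerivAt_log_det {n : ℕ} {X : Matrix (Fin n) (Fin n) ℝ}
    (hX : X.det ≠ 0) :
    ∃ f : Matrix (Fin n) (Fin n) ℝ →L[ℝ] ℝ,
      HasFDerivAt (fun Y : Matrix (Fin n) (Fin n) ℝ => Real.log Y.det) f X ∧
        ∀ E, f E = trace (X⁻¹ * E) := by
  obtain ⟨f, hf, hfE⟩ := X.exists_hasFDerivAt_det
  refine ⟨_, hf.log hX, fun E => ?_⟩
  change X.det⁻¹ * f E = _
  simp [hfE, inv_def, Ring.inverse_eq_inv']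

/-- The Fréchet derivative of the quadratic map `G ↦ V + G R Gᵀ`. -/
theorem Matrix.exists_hasFDerivAt_add_mul_mul_transpose {q t : ℕ}
    (R : Matrix (Fin q) (Fin q) ℝ) (V : Matrix (Fin t) (Fin t) ℝ)
    (G : Matrix (Fin t) (Fin q) ℝ) :
    ∃ f : Matrix (Fin t) (Fin q) ℝ →L[ℝ] Matrix (Fin t) (Fin t) ℝ,
      HasFDerivAt (fun K : Matrix (Fin t) (Fin q) ℝ => V + K * R * Kᵀ) f G ∧
        ∀ H, f H = G * R * Hᵀ + H * R * Gᵀ := by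
  let b : Matrix (Fin t) (Fin q) ℝ →ₗ[ℝ] Matrix (Fin t) (Fin q) ℝ →ₗ[ℝ]
      Matrix (Fin t) (Fin t) ℝ :=
    LinearMap.mk₂ ℝ (fun K L => K * R * Lᵀ) (by simp [Matrix.add_mul]) (by simp)
      (by simp [Matrix.mul_add]) (by simp)
  let B : Matrix (Fin t) (Fin q) ℝ →L[ℝ] Matrix (Fin t) (Fin q) ℝ →L[ℝ]
      Matrix (Fin t) (Fin t) ℝ :=
    (LinearMap.toContinuousLinearMap.toLinearMap ∘ₗ b).toContinuousLinearMap
  have hB := (B.hasFDerivAt_of_bilinear (hasFDerivAt_id G) (hasFDerivAt_id G)).const_add V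
  exact ⟨_, hB, fun H => rfl⟩

/-- The push-through identity
`(V + G R Gᵀ)⁻¹ G R = V⁻¹ G (R⁻¹ + Gᵀ V⁻¹ G)⁻¹`. -/
theorem Matrix.inv_add_mul_mul_transpose_mul {q t : ℕ}
    {R : Matrix (Fin q) (Fin q) ℝ} {V : Matrix (Fin t) (Fin t) ℝ}
    {G : Matrix (Fin t) (Fin q) ℝ} (hR : IsUnit R.det) (hV : IsUnit V.det)
    (hN : IsUnit (V + G * R * Gᵀ).det) (hW : IsUnit (R⁻¹ + Gᵀ * V⁻¹ * G).det) :
    (V + G * R * Gᵀ)⁻¹ * (G * R) = V⁻¹ * G * (R⁻¹ + Gᵀ * V⁻¹ * G)⁻¹ := by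
  have h : G * R * (R⁻¹ + Gᵀ * V⁻¹ * G) = (V + G * R * Gᵀ) * (V⁻¹ * G) := by
    rw [Matrix.mul_add, Matrix.add_mul, mul_nonsing_inv_cancel_right _ _ hR,
      mul_nonsing_inv_cancel_left _ _ hV]
    simp only [Matrix.mul_assoc]
  calc (V + G * R * Gᵀ)⁻¹ * (G * R)
      = (V + G * R * Gᵀ)⁻¹ * (G * R * (R⁻¹ + Gᵀ * V⁻¹ * G)) *
          (R⁻¹ + Gᵀ * V⁻¹ * G)⁻¹ := by
        rw [Matrix.mul_assoc _ (G * R * _), mul_nonsing_inv_cancel_right _ _ hW]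
    _ = _ := by rw [h, nonsing_inv_mul_cancel_left _ _ hN]

theorem Matrix.PosDef.add_mul_mul_transpose {q t : ℕ}
    {V : Matrix (Fin t) (Fin t) ℝ} (hV : V.PosDef)
    {R : Matrix (Fin q) (Fin q) ℝ} (hR : R.PosSemidef) (G : Matrix (Fin t) (Fin q) ℝ) :
    (V + G * R * Gᵀ).PosDef :=
  hV.add_posSemidef (by simpa using hR.mul_mul_conjTranspose_same G)

theorem Matrix.PosDef.inv_add_transpose_mul_mul {q t : ℕ}
    {V : Matrix (Fin t) (Fin t) ℝ} (hV : V.PosDef)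
    {R : Matrix (Fin q) (Fin q) ℝ} (hR : R.PosDef) (G : Matrix (Fin t) (Fin q) ℝ) :
    (R⁻¹ + Gᵀ * V⁻¹ * G).PosDef := by
  simpa using hR.inv.add_mul_mul_transpose hV.inv.posSemidef Gᵀ

/-- The Fréchet derivative of `G ↦ log det (V + G R Gᵀ)`. -/
theorem Matrix.exists_hasFDerivAt_log_det_add_mul_mul_transpose {q t : ℕ}
    {R : Matrix (Fin q) (Fin q) ℝ} (hR : R.PosDef)
    {V : Matrix (Fin t) (Fin t) ℝ} (hV : V.PosDef) (G : Matrix (Fin t) (Fin q) ℝ) :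
    ∃ f : Matrix (Fin t) (Fin q) ℝ →L[ℝ] ℝ,
      HasFDerivAt (fun K : Matrix (Fin t) (Fin q) ℝ =>
        Real.log (V + K * R * Kᵀ).det) f G ∧
        ∀ H, f H = 2 * trace (Hᵀ * (V⁻¹ * G * (R⁻¹ + Gᵀ * V⁻¹ * G)⁻¹)) := by
  have hN := hV.add_mul_mul_transpose hR.posSemidef G
  obtain ⟨f, hf, hfE⟩ := exists_hasFDerivAt_log_det hN.det_pos.ne'
  obtain ⟨g, hg, hgH⟩ := exists_hasFDerivAt_add_mul_mul_transpose R V G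
  refine ⟨f.comp g, HasFDerivAt.comp (g := fun Y : Matrix (Fin t) (Fin t) ℝ => Real.log Y.det) G hf hg, fun H => ?_⟩
  rw [← inv_add_mul_mul_transpose_mul hR.det_pos.ne'.isUnit hV.det_pos.ne'.isUnit
    hN.det_pos.ne'.isUnit (hV.inv_add_transpose_mul_mul hR G).det_pos.ne'.isUnit]
  have hRt : Rᵀ = R := by simpa using hR.isHermitian.eq
  have hNt : ((V + G * R * Gᵀ)⁻¹)ᵀ = (V + G * R * Gᵀ)⁻¹ := by
    simpa using hN.inv.isHermitian.eq
  have h_swap : trace ((V + G * R * Gᵀ)⁻¹ * (H * R * Gᵀ)) =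
      trace ((V + G * R * Gᵀ)⁻¹ * (G * R * Hᵀ)) := by
    rw [← trace_transpose, transpose_mul, hNt, trace_mul_comm]
    simp only [transpose_mul, transpose_transpose, hRt, Matrix.mul_assoc]
  have h_cycle : trace ((V + G * R * Gᵀ)⁻¹ * (G * R * Hᵀ)) =
      trace (Hᵀ * ((V + G * R * Gᵀ)⁻¹ * (G * R))) := by
    rw [← Matrix.mul_assoc, trace_mul_comm]
  rw [ContinuousLinearMap.comp_apply, hfE, hgH, Matrix.mul_add, trace_add, h_swap, h_cycle,
    two_mul]

/-- The information gain as a difference of log-determinants. -/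
theorem infoGain_eq_sub {p q t : ℕ}
    {Qθx : Matrix (Fin p) (Fin p) ℝ} (hQθx : Qθx.PosSemidef) (M : Matrix (Fin q) (Fin p) ℝ)
    {Qφθ : Matrix (Fin q) (Fin q) ℝ} (hQφθ : Qφθ.PosSemidef)
    {Qv : Matrix (Fin t) (Fin t) ℝ} (hQv : Qv.PosDef) (G : Matrix (Fin t) (Fin q) ℝ) :
    infoGain Qθx M Qφθ Qv G =
      (1 / 2 : ℝ) * (Real.log (Qv + G * (Qφθ + M * Qθx * Mᵀ) * Gᵀ).det -
        Real.log (Qv + G * Qφθ * Gᵀ).det) := by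
  have hS : (M * Qθx * Mᵀ).PosSemidef := by
    simpa using hQθx.mul_mul_conjTranspose_same M
  have h₁ := (hQv.add_mul_mul_transpose (hQφθ.add hS) G).det_pos
  have h₀ := (hQv.add_mul_mul_transpose hQφθ G).det_pos
  have h_det : (Qv + G * (Qφθ + M * Qθx * Mᵀ) * Gᵀ).det =
      (Qv + G * Qφθ * Gᵀ).det *
        (1 + Mᵀ * Gᵀ * (G * Qφθ * Gᵀ + Qv)⁻¹ * G * M * Qθx).det := by
    have h_split : Qv + G * (Qφθ + M * Qθx * Mᵀ) * Gᵀ =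
        (Qv + G * Qφθ * Gᵀ) + (G * M * Qθx) * (Mᵀ * Gᵀ) := by
      simp only [Matrix.mul_add, Matrix.add_mul, Matrix.mul_assoc, add_assoc]
    rw [h_split, det_add_mul _ _ h₀.ne'.isUnit, add_comm (G * Qφθ * Gᵀ) Qv]
    simp only [Matrix.mul_assoc]
  rw [← Real.log_div h₁.ne' h₀.ne', h_det, mul_div_cancel_left₀ _ h₀.ne']
  rfl

/-- `P⁻¹ S (1 + P⁻¹ S)⁻¹ P⁻¹ = P⁻¹ - (P + S)⁻¹`. -/
theorem Matrix.inv_mul_mul_inv_one_add_mul_inv {q : ℕ} {P S : Matrix (Fin q) (Fin q) ℝ}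
    (hP : IsUnit P.det) (hPS : IsUnit (P + S).det) :
    P⁻¹ * S * (1 + P⁻¹ * S)⁻¹ * P⁻¹ = P⁻¹ - (P + S)⁻¹ := by
  have h : 1 + P⁻¹ * S = P⁻¹ * (P + S) := by
    rw [Matrix.mul_add, nonsing_inv_mul _ hP]
  have h_inv : (1 + P⁻¹ * S)⁻¹ * P⁻¹ = (P + S)⁻¹ := by
    rw [h, mul_inv_rev, nonsing_inv_nonsing_inv _ hP, mul_nonsing_inv_cancel_right _ _ hP]
  have h_sub : P⁻¹ * S = P⁻¹ * (P + S) - 1 := by rw [← h, add_sub_cancel_left]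
  rw [Matrix.mul_assoc, h_inv, h_sub, Matrix.sub_mul, mul_nonsing_inv_cancel_right _ _ hPS,
    Matrix.one_mul]

/-- gradient of the information gain. With
`B = Qφθ⁻¹ M Qθx Mᵀ (I + Qφθ⁻¹ M Qθx Mᵀ)⁻¹ Qφθ⁻¹`, the matrix
`(Qφθ⁻¹ + Gᵀ Qv⁻¹ G) - B` is invertible, `D` is Fréchet differentiable at `G`,
and its derivative in direction `H` is `tr (Hᵀ ∇D)` for the stated `∇D`. -/
theorem infoGain_gradient (p q t : ℕ) (hp : 0 < p) (hq : 0 < q) (ht : 0 < t)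
    (Qθx : Matrix (Fin p) (Fin p) ℝ) (hQθx : Qθx.PosDef)
    (M : Matrix (Fin q) (Fin p) ℝ)
    (Qφθ : Matrix (Fin q) (Fin q) ℝ) (hQφθ : Qφθ.PosSemidef)
    (hQφθpd : Qφθ.PosDef)
    (Qv : Matrix (Fin t) (Fin t) ℝ) (hQv : Qv.PosDef)
    (G : Matrix (Fin t) (Fin q) ℝ) :
    IsUnit ((Qφθ⁻¹ + Gᵀ * Qv⁻¹ * G) -
        Qφθ⁻¹ * M * Qθx * Mᵀ * (1 + Qφθ⁻¹ * M * Qθx * Mᵀ)⁻¹ * Qφθ⁻¹) ∧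
      ∃ f : Matrix (Fin t) (Fin q) ℝ →L[ℝ] ℝ,
        HasFDerivAt (infoGain Qθx M Qφθ Qv) f G ∧
          ∀ H : Matrix (Fin t) (Fin q) ℝ,
            f H = trace (Hᵀ *
              (Qv⁻¹ * G *
                ((Qφθ⁻¹ + Gᵀ * Qv⁻¹ * G) -
                  Qφθ⁻¹ * M * Qθx * Mᵀ * (1 + Qφθ⁻¹ * M * Qθx * Mᵀ)⁻¹ * Qφθ⁻¹)⁻¹ *
                (Qφθ⁻¹ * M * Qθx * Mᵀ * (1 + Qφθ⁻¹ * M * Qθx * Mᵀ)⁻¹ * Qφθ⁻¹) *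
                (Qφθ⁻¹ + Gᵀ * Qv⁻¹ * G)⁻¹)) := by
  have hS : (M * Qθx * Mᵀ).PosSemidef := by
    simpa using hQθx.posSemidef.mul_mul_conjTranspose_same M
  have hPS : (Qφθ + M * Qθx * Mᵀ).PosDef := hQφθpd.add_posSemidef hS
  have hB : Qφθ⁻¹ * M * Qθx * Mᵀ * (1 + Qφθ⁻¹ * M * Qθx * Mᵀ)⁻¹ * Qφθ⁻¹ =
      Qφθ⁻¹ - (Qφθ + M * Qθx * Mᵀ)⁻¹ := by
    rw [← inv_mul_mul_inv_one_add_mul_inv hQφθpd.det_pos.ne'.isUnit hPS.det_pos.ne'.isUnit]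
    simp only [Matrix.mul_assoc]
  have hW₀ := hQv.inv_add_transpose_mul_mul hQφθpd G
  have hW₁ := hQv.inv_add_transpose_mul_mul hPS G
  have h_sub : (Qφθ⁻¹ + Gᵀ * Qv⁻¹ * G) - (Qφθ⁻¹ - (Qφθ + M * Qθx * Mᵀ)⁻¹) =
      (Qφθ + M * Qθx * Mᵀ)⁻¹ + Gᵀ * Qv⁻¹ * G := by abel
  rw [hB, h_sub]
  refine ⟨hW₁.isUnit, ?_⟩
  obtain ⟨f₁, hf₁, hf₁H⟩ := exists_hasFDerivAt_log_det_add_mul_mul_transpose hPS hQv G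
  obtain ⟨f₀, hf₀, hf₀H⟩ := exists_hasFDerivAt_log_det_add_mul_mul_transpose hQφθpd hQv G
  refine ⟨(1 / 2 : ℝ) • (f₁ - f₀), ?_, fun H => ?_⟩
  · rw [funext (infoGain_eq_sub hQθx.posSemidef M hQφθ hQv)]
    exact (hf₁.sub hf₀).const_mul (1 / 2 : ℝ)
  · have h_inv : ((Qφθ + M * Qθx * Mᵀ)⁻¹ + Gᵀ * Qv⁻¹ * G)⁻¹ *
        (Qφθ⁻¹ - (Qφθ + M * Qθx * Mᵀ)⁻¹) * (Qφθ⁻¹ + Gᵀ * Qv⁻¹ * G)⁻¹ =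
        ((Qφθ + M * Qθx * Mᵀ)⁻¹ + Gᵀ * Qv⁻¹ * G)⁻¹ - (Qφθ⁻¹ + Gᵀ * Qv⁻¹ * G)⁻¹ := by
      rw [inv_sub_inv (iff_of_true hW₁.isUnit hW₀.isUnit), add_sub_add_right_eq_sub]
    have h_grad : Qv⁻¹ * G * ((Qφθ + M * Qθx * Mᵀ)⁻¹ + Gᵀ * Qv⁻¹ * G)⁻¹ *
        (Qφθ⁻¹ - (Qφθ + M * Qθx * Mᵀ)⁻¹) * (Qφθ⁻¹ + Gᵀ * Qv⁻¹ * G)⁻¹ =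
        Qv⁻¹ * G * ((Qφθ + M * Qθx * Mᵀ)⁻¹ + Gᵀ * Qv⁻¹ * G)⁻¹ -
          Qv⁻¹ * G * (Qφθ⁻¹ + Gᵀ * Qv⁻¹ * G)⁻¹ := by
      rw [← Matrix.mul_sub, ← h_inv]
      simp only [Matrix.mul_assoc]
    rw [h_grad, Matrix.mul_sub, trace_sub, _root_.smul_apply, _root_.sub_apply, hf₁H, hf₀H,
      smul_eq_mul]
    ring
end

section
/- (Lemma 2) Suppose Q_{vv} = σ²_v · I_t with σ²_v > 0. Then for every t×q real matrix G of rank r ≥ 1, there exists an r×q real matrix G̃ with tr(G̃ G̃ᵀ) = tr(G Gᵀ) such that the r-dimensional channel achieves the same information gain: (1/2)·log det(I_p + Mᵀ G̃ᵀ (G̃ Q_{φφ|θ} G̃ᵀ + σ²_v · I_r)⁻¹ G̃ M Q_{θθ|x}) = D(G). -/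
open Matrix

/-- A real matrix factors through an orthonormal basis of its column space. -/
theorem exists_orthonormal_cols_of_rank_eq {t q r : ℕ} (G : Matrix (Fin t) (Fin q) ℝ)
    (hrank : G.rank = r) :
    ∃ U : Matrix (Fin t) (Fin r) ℝ, Uᵀ * U = 1 ∧ U * (Uᵀ * G) = G := by
  let e := (WithLp.linearEquiv 2 ℝ (Fin t → ℝ)).symm
  let S := (Submodule.span ℝ (Set.range G.col)).map e.toLinearMap
  have hS : Module.finrank ℝ S = r := by
    rw [← hrank, Matrix.rank_eq_finrank_span_cols]
    exact LinearEquiv.finrank_map_eq e _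
  obtain ⟨b⟩ : Nonempty (OrthonormalBasis (Fin r) ℝ S) :=
    ⟨(stdOrthonormalBasis ℝ S).reindex (finCongr hS)⟩
  refine ⟨Matrix.of fun i j => (b j : EuclideanSpace ℝ (Fin t)) i, ?_, ?_⟩
  · ext i j
    have h := orthonormal_iff_ite.mp b.orthonormal i j
    rw [Submodule.coe_inner, PiLp.inner_apply] at h
    rw [Matrix.mul_apply, Matrix.one_apply]
    exact (Finset.sum_congr rfl fun l _ => mul_comm _ _).trans h
  · ext i k
    have hk : e (G.col k) ∈ S :=
      Submodule.mem_map_of_mem (Submodule.subset_span ⟨k, rfl⟩)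
    have h := congrArg (fun x : S => (x : EuclideanSpace ℝ (Fin t)) i)
      (b.sum_repr' ⟨e (G.col k), hk⟩)
    simp only [Submodule.coe_sum, Submodule.coe_smul, WithLp.ofLp_sum, Finset.sum_apply,
      WithLp.ofLp_smul, Pi.smul_apply, smul_eq_mul, Submodule.coe_inner, PiLp.inner_apply] at h
    simp only [Matrix.mul_apply, Matrix.transpose_apply, Matrix.of_apply]
    refine Eq.trans (Finset.sum_congr rfl fun j _ => ?_) h
    rw [mul_comm]
    congr 1
    exact Finset.sum_congr rfl fun l _ => mul_comm _ _

/-- Compressing the inverse of `U * A * Uᵀ + s • 1` to the range of an isometry `U`. -/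
theorem transpose_mul_inv_mul_of_orthonormal_cols {m n : Type*} [Fintype m] [DecidableEq m]
    [Fintype n] [DecidableEq n] {U : Matrix m n ℝ} (hU : Uᵀ * U = 1) {A : Matrix n n ℝ}
    (hA : A.PosSemidef) {s : ℝ} (hs : 0 < s) :
    Uᵀ * (U * A * Uᵀ + s • (1 : Matrix m m ℝ))⁻¹ * U = (A + s • (1 : Matrix n n ℝ))⁻¹ := by
  have hB : IsUnit (U * A * Uᵀ + s • (1 : Matrix m m ℝ)).det := by
    have h : (U * A * Uᵀ).PosSemidef := by
      simpa using hA.mul_mul_conjTranspose_same U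
    exact (Matrix.PosDef.posSemidef_add h (Matrix.PosDef.one.smul hs)).det_pos.ne'.isUnit
  have hBU : (U * A * Uᵀ + s • (1 : Matrix m m ℝ)) * U = U * (A + s • (1 : Matrix n n ℝ)) := by
    simp [Matrix.add_mul, Matrix.mul_add, Matrix.mul_assoc, hU]
  symm
  apply Matrix.inv_eq_left_inv
  rw [Matrix.mul_assoc, ← hBU, Matrix.mul_assoc, Matrix.nonsing_inv_mul_cancel_left _ _ hB, hU]

/-- Lemma 2: with white noise, for any channel matrix `G` of
rank `r ≥ 1` there is an `r`-dimensional channel with the same total power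
achieving the same information gain. -/
theorem rank_reduced_channel (p q t : ℕ) (hp : 0 < p) (hq : 0 < q) (ht : 0 < t)
    (Qθx : Matrix (Fin p) (Fin p) ℝ) (hQθx : Qθx.PosDef)
    (M : Matrix (Fin q) (Fin p) ℝ)
    (Qφθ : Matrix (Fin q) (Fin q) ℝ) (hQφθ : Qφθ.PosSemidef)
    (σv2 : ℝ) (hσv2 : 0 < σv2)
    (G : Matrix (Fin t) (Fin q) ℝ) (r : ℕ) (hr : 1 ≤ r) (hrank : G.rank = r) :
    ∃ Gt : Matrix (Fin r) (Fin q) ℝ,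
      trace (Gt * Gtᵀ) = trace (G * Gᵀ) ∧
        (1 / 2 : ℝ) *
            Real.log ((1 + Mᵀ * Gtᵀ *
              (Gt * Qφθ * Gtᵀ + σv2 • (1 : Matrix (Fin r) (Fin r) ℝ))⁻¹ *
              Gt * M * Qθx).det) =
          infoGain Qθx M Qφθ (σv2 • (1 : Matrix (Fin t) (Fin t) ℝ)) G := by
  obtain ⟨U, hU, hG⟩ := exists_orthonormal_cols_of_rank_eq G hrank
  obtain ⟨H, hH⟩ : ∃ H, H = Uᵀ * G := ⟨_, rfl⟩
  rw [← hH] at hG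
  subst hG
  refine ⟨H, ?_, ?_⟩
  · rw [Matrix.transpose_mul, Matrix.mul_assoc U, Matrix.trace_mul_comm U, Matrix.mul_assoc H,
      Matrix.mul_assoc Hᵀ, hU, Matrix.mul_one]
  · have hA : (H * Qφθ * Hᵀ).PosSemidef := by
      simpa using hQφθ.mul_mul_conjTranspose_same H
    rw [infoGain, ← transpose_mul_inv_mul_of_orthonormal_cols hU hA hσv2]
    simp only [Matrix.transpose_mul, Matrix.mul_assoc]
end

section
/- (Log-determinant decomposition of the information gain) Suppose the diagonal entries of Σ_v are all positive and the diagonal entries of Σ_ξ are all nonnegative. Then for every t×q real matrix Φ, D(Φ) = (1/2)·log det(I_q + Σ_ξ) + (1/2)·log det( I_q − (I_q + Φᵀ Σ_v⁻¹ Φ)⁻¹ Σ_ξ (I_q + Σ_ξ)⁻¹ ). -/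
open Matrix

/-- Push-through form of the Woodbury identity. -/
theorem transpose_mul_inv_mul_eq_one_sub {m n : Type*} [Fintype m] [DecidableEq m]
    [Fintype n] [DecidableEq n] (Φ : Matrix m n ℝ) {V : Matrix m m ℝ} (hV : V.PosDef) :
    Φᵀ * (Φ * Φᵀ + V)⁻¹ * Φ = 1 - (1 + Φᵀ * V⁻¹ * Φ)⁻¹ := by
  have hsum : (Φ * Φᵀ + V).PosDef := by
    have h := posSemidef_self_mul_conjTranspose Φ
    rw [conjTranspose_eq_transpose_of_trivial] at h
    exact PosDef.posSemidef_add h hV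
  have hinv : V⁻¹⁻¹ = V := nonsing_inv_nonsing_inv V ((isUnit_iff_isUnit_det V).1 hV.isUnit)
  have h := add_mul_mul_inv_eq_sub (1 : Matrix n n ℝ) Φᵀ V⁻¹ Φ isUnit_one hV.inv.isUnit
    (by simpa [hinv, add_comm] using hsum.isUnit)
  rw [h]
  simp [hinv, add_comm]

/-- `det (1 + M D)` is positive for `M` positive semidefinite and `D` diagonal nonnegative. -/
theorem det_one_add_mul_diagonal_pos {n : Type*} [Fintype n] [DecidableEq n]
    {M : Matrix n n ℝ} (hM : M.PosSemidef) {d : n → ℝ} (hd : ∀ i, 0 ≤ d i) :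
    0 < (1 + M * diagonal d).det := by
  have hsq : diagonal d = diagonal (fun i => √(d i)) * diagonal (fun i => √(d i)) := by
    simp [diagonal_mul_diagonal, Real.mul_self_sqrt (hd _)]
  rw [hsq, ← Matrix.mul_assoc, det_one_add_mul_comm, ← Matrix.mul_assoc]
  have h := hM.mul_mul_conjTranspose_same (diagonal fun i => √(d i))
  rw [conjTranspose_eq_transpose_of_trivial, diagonal_transpose] at h
  exact (PosDef.one.add_posSemidef h).det_pos

/-- log-determinant decomposition of the information gain. -/
theorem infoGain_logdet_decomp (t q : ℕ) (ht : 0 < t) (htq : t ≤ q)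
    (σv : Fin t → ℝ) (σξ : Fin q → ℝ)
    (hσv_pos : ∀ i, 0 < σv i) (hσξ_nonneg : ∀ j, 0 ≤ σξ j)
    (Φ : Matrix (Fin t) (Fin q) ℝ) :
    infoGainPhi σv σξ Φ =
      (1 / 2 : ℝ) * Real.log ((1 + diagonal σξ).det) +
        (1 / 2 : ℝ) *
          Real.log ((1 - (1 + Φᵀ * (diagonal σv)⁻¹ * Φ)⁻¹ * diagonal σξ *
            (1 + diagonal σξ)⁻¹).det) := by
  have hV : (diagonal σv).PosDef := PosDef.diagonal hσv_pos
  have hX : 0 < (1 + diagonal σξ).det := by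
    simpa using det_one_add_mul_diagonal_pos PosSemidef.one hσξ_nonneg
  have hM : (Φᵀ * (Φ * Φᵀ + diagonal σv)⁻¹ * Φ).PosSemidef := by
    have h := posSemidef_self_mul_conjTranspose Φ
    have h' := ((PosDef.posSemidef_add h hV).inv.posSemidef).conjTranspose_mul_mul_same Φ
    simpa only [conjTranspose_eq_transpose_of_trivial] using h'
  have hdet := det_one_add_mul_diagonal_pos hM hσξ_nonneg
  have hfactor : 1 + Φᵀ * (Φ * Φᵀ + diagonal σv)⁻¹ * Φ * diagonal σξ =
      (1 - (1 + Φᵀ * (diagonal σv)⁻¹ * Φ)⁻¹ * diagonal σξ * (1 + diagonal σξ)⁻¹) *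
        (1 + diagonal σξ) := by
    rw [transpose_mul_inv_mul_eq_one_sub Φ hV, Matrix.sub_mul, Matrix.sub_mul,
      nonsing_inv_mul_cancel_right _ _ hX.ne'.isUnit]
    noncomm_ring
  rw [hfactor, det_mul] at hdet
  rw [infoGainPhi, hfactor, det_mul,
    Real.log_mul (left_ne_zero_of_mul hdet.ne') hX.ne']
  ring
end

section
/- (Closed form of the information gain for permuted diagonal channel matrices) Suppose the diagonal entries of Σ_v are all positive and the diagonal entries of Σ_ξ are all nonnegative. Let π₁ be a permutation of {1, …, q}, π₂ a permutation of {1, …, t}, Π₁ and Π₂ the corresponding q×q and t×t permutation matrices (with entry 1 in position (π(i), i)), and Λ the t×q diagonal matrix with diagonal entries λ_{11}, …, λ_{tt}. Then for Φ = Π₂ Λ Π₁ᵀ one has D(Φ) = (1/2)·∑_{i=1}^{t} log( 1 + σ²_{ξ,π₁(i)} λ_{ii}² / (λ_{ii}² + σ²_{v,π₂(i)}) ). -/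
open Matrix

/-- A matrix whose rows are supported on distinct single columns diagonalizes
`Φ * diagonal s * Φᵀ`. -/
theorem mul_diagonal_mul_transpose_of_injective {m n : Type*} [Fintype n] [DecidableEq m]
    [DecidableEq n] {e : m → n} (he : Function.Injective e) (c : m → ℝ) (s : n → ℝ) :
    (Matrix.of fun i j => if j = e i then c i else 0) * diagonal s *
        (Matrix.of fun i j => if j = e i then c i else 0)ᵀ =
      diagonal fun i => s (e i) * c i ^ 2 := by
  ext i k
  rw [mul_apply]
  simp only [mul_diagonal, of_apply, transpose_apply, ite_mul, zero_mul, Finset.sum_ite_eq',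
    Finset.mem_univ, if_true, diagonal_apply, he.eq_iff]
  split_ifs with h
  · subst h; ring
  · simp

/-- The information gain of a channel matrix whose rows are supported on distinct single
columns. -/
theorem infoGainPhi_of_injective {t q : ℕ} {σv : Fin t → ℝ} {σξ : Fin q → ℝ}
    (hσv : ∀ i, 0 < σv i) (hσξ : ∀ j, 0 ≤ σξ j) {e : Fin t → Fin q}
    (he : Function.Injective e) (c : Fin t → ℝ) :
    infoGainPhi σv σξ (Matrix.of fun i j => if j = e i then c i else 0) =
      (1 / 2 : ℝ) * ∑ i, Real.log (1 + σξ (e i) * c i ^ 2 / (c i ^ 2 + σv i)) := by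
  have hpos (i : Fin t) : 0 < c i ^ 2 + σv i := add_pos_of_nonneg_of_pos (sq_nonneg _) (hσv i)
  have hgram := mul_diagonal_mul_transpose_of_injective he c 1
  have hsignal := mul_diagonal_mul_transpose_of_injective he c σξ
  unfold infoGainPhi
  set Φ : Matrix (Fin t) (Fin q) ℝ := Matrix.of fun i j => if j = e i then c i else 0
  have hinv : (Φ * Φᵀ + diagonal σv)⁻¹ = diagonal fun i => (c i ^ 2 + σv i)⁻¹ := by
    simp only [diagonal_one', Matrix.mul_one, Pi.one_apply, one_mul] at hgram
    rw [hgram, diagonal_add]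
    apply inv_eq_right_inv
    rw [diagonal_mul_diagonal, ← diagonal_one]
    congr 1
    funext i
    exact mul_inv_cancel₀ (hpos i).ne'
  rw [hinv, Matrix.mul_assoc, Matrix.mul_assoc, det_one_add_mul_comm, Matrix.mul_assoc, hsignal,
    diagonal_mul_diagonal, ← diagonal_one, diagonal_add, det_diagonal, Real.log_prod]
  · simp only [div_eq_inv_mul]
  · intro i _
    have := mul_nonneg (inv_nonneg.2 (hpos i).le) (mul_nonneg (hσξ (e i)) (sq_nonneg (c i)))
    positivity

/-- closed form of the information gain for permuted diagonal
channel matrices `Φ = Π₂ Λ Π₁ᵀ`, where `Π₁, Π₂` are the permutation matrices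
with entry 1 in position `(π(i), i)` and `Λ` is the `t × q` diagonal matrix
with diagonal entries `lam i`. -/
theorem infoGain_perm_diagonal (t q : ℕ) (ht : 0 < t) (htq : t ≤ q)
    (σv : Fin t → ℝ) (σξ : Fin q → ℝ)
    (hσv_pos : ∀ i, 0 < σv i) (hσξ_nonneg : ∀ j, 0 ≤ σξ j)
    (π₁ : Equiv.Perm (Fin q)) (π₂ : Equiv.Perm (Fin t))
    (lam : Fin t → ℝ) :
    infoGainPhi σv σξ
        ((Matrix.of fun i j : Fin t => if i = π₂ j then (1 : ℝ) else 0) *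
          (Matrix.of fun (i : Fin t) (j : Fin q) =>
            if (j : ℕ) = (i : ℕ) then lam i else 0) *
          (Matrix.of fun i j : Fin q => if i = π₁ j then (1 : ℝ) else 0)ᵀ) =
      (1 / 2 : ℝ) * ∑ i : Fin t,
        Real.log (1 + σξ (π₁ (Fin.castLE htq i)) * (lam i) ^ 2 /
          ((lam i) ^ 2 + σv (π₂ i))) := by
  have he : Function.Injective fun i => π₁ (Fin.castLE htq (π₂.symm i)) :=
    π₁.injective.comp ((Fin.castLE_injective htq).comp π₂.symm.injective)
  have hΦ : ((Matrix.of fun i j : Fin t => if i = π₂ j then (1 : ℝ) else 0) *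
      (Matrix.of fun (i : Fin t) (j : Fin q) => if (j : ℕ) = (i : ℕ) then lam i else 0) *
      (Matrix.of fun i j : Fin q => if i = π₁ j then (1 : ℝ) else 0)ᵀ) =
      Matrix.of fun i j =>
        if j = π₁ (Fin.castLE htq (π₂.symm i)) then lam (π₂.symm i) else 0 := by
    ext i j
    simp only [mul_apply, of_apply, transpose_apply, ← Equiv.symm_apply_eq, ite_mul, mul_ite,
      one_mul, mul_one, zero_mul, mul_zero, Fin.ext_iff, Fin.val_castLE]
    simp only [← Fin.ext_iff, Finset.sum_ite_eq, Finset.mem_univ, if_true]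
    rw [Finset.sum_eq_single (π₂.symm i)]
    · simp
    · intro x _ hx
      simp [hx.symm]
    · simp
  rw [hΦ, infoGainPhi_of_injective hσv_pos hσξ_nonneg he, ← Equiv.sum_comp π₂]
  simp only [Equiv.symm_apply_apply]
end

section
/- (Optimality of the identity pairing of subchannels) Let t ≤ q, let 0 < b_1 < b_2 < … < b_t and a_1 > a_2 > … > a_q ≥ 0 be real numbers, and let P > 0. For a permutation π₁ of {1, …, q} and a permutation π₂ of {1, …, t}, define f(π₁, π₂) = sup over all real vectors (λ_1, …, λ_t) with ∑_{i=1}^{t} λ_i² ≤ P of (1/2)·∑_{i=1}^{t} log( 1 + a_{π₁(i)} λ_i² / (λ_i² + b_{π₂(i)}) ). Then the identity permutations are optimal: f(id, id) ≥ f(π₁, π₂) for all permutations π₁, π₂. -/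
/-- The supremum of the total information over power allocations, for the
pairing of signal eigenvalues `a ∘ π₁` with noise eigenvalues `b ∘ π₂`. -/
noncomputable def pairingValue {t q : ℕ} (htq : t ≤ q)
    (a : Fin q → ℝ) (b : Fin t → ℝ) (P : ℝ)
    (π₁ : Equiv.Perm (Fin q)) (π₂ : Equiv.Perm (Fin t)) : ℝ :=
  sSup {x : ℝ | ∃ lam : Fin t → ℝ, (∑ i, (lam i) ^ 2 ≤ P) ∧
    x = (1 / 2 : ℝ) * ∑ i : Fin t,
      Real.log (1 + a (π₁ (Fin.castLE htq i)) * (lam i) ^ 2 /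
        ((lam i) ^ 2 + b (π₂ i)))}

/-- Monge arrays: if `G` satisfies the supermodular exchange inequality, then the sum of its
entries along a permutation is maximal on the diagonal. -/
theorem sum_perm_le_sum_diag_of_supermodular {n : ℕ} (G : Fin n → Fin n → ℝ)
    (hG : ∀ i j k l, i ≤ j → k ≤ l → G j k + G i l ≤ G i k + G j l)
    (π : Equiv.Perm (Fin n)) : ∑ i, G (π i) i ≤ ∑ i, G i i := by
  induction n with
  | zero => simp
  | succ n ih =>
    obtain ⟨⟨p, e⟩, rfl⟩ := Equiv.Perm.decomposeFin.symm.surjective π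
    have tail := ih (fun i j => G i.succ j.succ)
      (fun i j k l hij hkl => hG _ _ _ _ (Fin.succ_le_succ_iff.2 hij)
        (Fin.succ_le_succ_iff.2 hkl)) e
    rw [Fin.sum_univ_succ, Fin.sum_univ_succ (fun i => G i i)]
    simp only [Equiv.Perm.decomposeFin_symm_apply_zero,
      Equiv.Perm.decomposeFin_symm_apply_succ]
    refine Fin.cases ?_ (fun p => ?_) p
    · simpa using tail
    · have exchange := hG 0 p.succ 0 (e.symm p).succ (Fin.zero_le _) (Fin.zero_le _)
      have swapped : ∑ i, G (Equiv.swap 0 p.succ (e i).succ) i.succ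
          = ∑ i, G (e i).succ i.succ
            + (G 0 (e.symm p).succ - G p.succ (e.symm p).succ) := by
        rw [← sub_eq_iff_eq_add', ← Finset.sum_sub_distrib,
          Finset.sum_eq_single (e.symm p)]
        · simp
        · intro i _ hi
          have hne : (e i).succ ≠ p.succ := fun h =>
            hi (e.symm_apply_eq.2 (Fin.succ_injective _ h).symm).symm
          rw [Equiv.swap_apply_of_ne_of_ne (Fin.succ_ne_zero _) hne, sub_self]
        · simp
      linarith

/-- Rearrangement inequality for `log (1 + a * u)` with a possibly longer family `a`. -/
theorem sum_log_one_add_mul_perm_le {t q : ℕ} (htq : t ≤ q) {a : Fin q → ℝ} {u : Fin t → ℝ}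
    (ha : Antitone a) (ha_nonneg : ∀ j, 0 ≤ a j) (hu : Antitone u) (hu_nonneg : ∀ i, 0 ≤ u i)
    (π : Equiv.Perm (Fin q)) :
    ∑ i, Real.log (1 + a (π (Fin.castLE htq i)) * u i)
      ≤ ∑ i, Real.log (1 + a (Fin.castLE htq i) * u i) := by
  have inj := Fin.castLE_injective htq
  set v : Fin q → ℝ := Function.extend (Fin.castLE htq) u 0
  have v_cast (i : Fin t) : v (Fin.castLE htq i) = u i := inj.extend_apply _ _ _
  have v_zero (j : Fin q) (hj : j ∉ Set.range (Fin.castLE htq)) : v j = 0 :=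
    Function.extend_apply' _ _ _ hj
  have v_nonneg (j : Fin q) : 0 ≤ v j := by
    by_cases hj : j ∈ Set.range (Fin.castLE htq)
    · obtain ⟨i, rfl⟩ := hj
      simpa only [v_cast] using hu_nonneg i
    · exact (v_zero j hj).ge
  have v_anti : Antitone v := by
    intro j k hjk
    by_cases hk : k ∈ Set.range (Fin.castLE htq)
    · obtain ⟨k, rfl⟩ := hk
      obtain ⟨j, rfl⟩ : j ∈ Set.range (Fin.castLE htq) :=
        ⟨⟨j, lt_of_le_of_lt (Fin.le_def.1 hjk) k.2⟩, rfl⟩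
      simp only [v_cast]
      exact hu hjk
    · rw [v_zero k hk]
      exact v_nonneg j
  have extend_sum (ρ : Equiv.Perm (Fin q)) :
      ∑ i, Real.log (1 + a (ρ (Fin.castLE htq i)) * u i)
        = ∑ j, Real.log (1 + a (ρ j) * v j) :=
    Fintype.sum_of_injective _ inj _ _ (fun j hj => by simp [v_zero j hj])
      (fun i => by rw [v_cast])
  have pos (i j : Fin q) : 0 < 1 + a i * v j := by
    have := mul_nonneg (ha_nonneg i) (v_nonneg j)
    linarith
  have key := sum_perm_le_sum_diag_of_supermodular (fun i j => Real.log (1 + a i * v j))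
    (fun i j k l hij hkl => by
      rw [← Real.log_mul (pos _ _).ne' (pos _ _).ne',
        ← Real.log_mul (pos _ _).ne' (pos _ _).ne']
      refine Real.log_le_log (mul_pos (pos _ _) (pos _ _)) ?_
      nlinarith [mul_nonneg (sub_nonneg.2 (ha hij)) (sub_nonneg.2 (v_anti hkl))]) π
  have h_one := extend_sum 1
  simp only [Equiv.Perm.one_apply] at h_one
  rw [extend_sum, h_one]
  exact key

/-- Every allocation for an arbitrary pairing is dominated, in power and in information, by an
allocation for the identity pairing. -/
theorem exists_allocation_identity_pairing {t q : ℕ} (htq : t ≤ q) {a : Fin q → ℝ}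
    {b : Fin t → ℝ} (hb_pos : ∀ i, 0 < b i) (hb : Monotone b) (ha_nonneg : ∀ j, 0 ≤ a j)
    (ha : Antitone a) (π₁ : Equiv.Perm (Fin q)) (π₂ : Equiv.Perm (Fin t)) (lam : Fin t → ℝ) :
    ∃ mu : Fin t → ℝ, ∑ i, mu i ^ 2 ≤ ∑ i, lam i ^ 2 ∧
      ∑ i, Real.log (1 + a (π₁ (Fin.castLE htq i)) * lam i ^ 2 / (lam i ^ 2 + b (π₂ i)))
        ≤ ∑ i, Real.log (1 + a (Fin.castLE htq i) * mu i ^ 2 / (mu i ^ 2 + b i)) := by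
  set S : Fin t → ℝ := fun i => lam i ^ 2 / b (π₂ i)
  have S_nonneg (i : Fin t) : 0 ≤ S i := div_nonneg (sq_nonneg _) (hb_pos _).le
  have S_mul (i : Fin t) : b (π₂ i) * S i = lam i ^ 2 := mul_div_cancel₀ _ (hb_pos _).ne'
  set σ : Equiv.Perm (Fin t) := Tuple.sort (fun i => -S i)
  have S_anti : Antitone (S ∘ σ) := fun i j hij =>
    neg_le_neg_iff.1 (Tuple.monotone_sort (fun i => -S i) hij)
  have mu_sq (i : Fin t) : √(b i * S (σ i)) ^ 2 = b i * S (σ i) :=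
    Real.sq_sqrt (mul_nonneg (hb_pos i).le (S_nonneg _))
  have ratio {β s : ℝ} (α : ℝ) (hβ : 0 < β) (hs : 0 ≤ s) :
      α * (β * s) / (β * s + β) = α * (s / (1 + s)) := by
    have : 1 + s ≠ 0 := by positivity
    have : β * s + β ≠ 0 := by positivity
    field_simp
    ring
  refine ⟨fun i => √(b i * S (σ i)), ?_, ?_⟩
  · simp only [mu_sq, ← S_mul]
    rw [← Equiv.sum_comp σ (fun i => b (π₂ i) * S i)]
    exact (hb.antivary S_anti).sum_mul_le_sum_comp_perm_mul (σ := σ.trans π₂)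
  · simp only [mu_sq, ← S_mul]
    simp only [ratio _ (hb_pos _) (S_nonneg _)]
    have key := sum_log_one_add_mul_perm_le htq ha ha_nonneg
      (u := fun i => S (σ i) / (1 + S (σ i)))
      (fun i j hij => by
        have hi := S_nonneg (σ i)
        have hj := S_nonneg (σ j)
        have hS : S (σ j) ≤ S (σ i) := S_anti hij
        change S (σ j) / (1 + S (σ j)) ≤ S (σ i) / (1 + S (σ i))
        rw [div_le_div_iff₀ (by positivity) (by positivity)]
        linarith)
      (fun i => div_nonneg (S_nonneg _) (add_nonneg zero_le_one (S_nonneg _)))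
      ((σ.viaFintypeEmbedding (Fin.castLEEmb htq)).trans π₁)
    rw [← Equiv.sum_comp σ]
    convert key using 6 with i
    exact congrArg π₁ (σ.viaFintypeEmbedding_apply_image (Fin.castLEEmb htq) i).symm

/-- the identity pairing of subchannels is optimal. -/
theorem identity_pairing_optimal (t q : ℕ) (ht : 0 < t) (htq : t ≤ q)
    (b : Fin t → ℝ) (hb_pos : ∀ i, 0 < b i)
    (hb_mono : ∀ i j : Fin t, i < j → b i < b j)
    (a : Fin q → ℝ) (ha_nonneg : ∀ j, 0 ≤ a j)
    (ha_anti : ∀ i j : Fin q, i < j → a j < a i)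
    (P : ℝ) (hP : 0 < P)
    (π₁ : Equiv.Perm (Fin q)) (π₂ : Equiv.Perm (Fin t)) :
    pairingValue htq a b P π₁ π₂ ≤ pairingValue htq a b P 1 1 := by
  have hb : Monotone b := StrictMono.monotone fun i j hij => hb_mono i j hij
  have ha : Antitone a := StrictAnti.antitone fun i j hij => ha_anti i j hij
  refine csSup_le ⟨_, 0, by simpa using hP.le, rfl⟩ ?_
  rintro x ⟨lam, hlam, rfl⟩
  obtain ⟨mu, hmu, hle⟩ :=
    exists_allocation_identity_pairing htq hb_pos hb ha_nonneg ha π₁ π₂ lam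
  refine (mul_le_mul_of_nonneg_left hle (by norm_num)).trans
    (le_csSup ?_ ⟨mu, hmu.trans hlam, rfl⟩)
  refine ⟨1 / 2 * ∑ i, Real.log (1 + a (Fin.castLE htq i)), ?_⟩
  rintro x ⟨nu, -, rfl⟩
  refine mul_le_mul_of_nonneg_left (Finset.sum_le_sum fun i _ => ?_) (by norm_num)
  simp only [Equiv.Perm.one_apply]
  have h_sq := sq_nonneg (nu i)
  have hbi := hb_pos i
  have hai := ha_nonneg (Fin.castLE htq i)
  refine Real.log_le_log (by positivity) (add_le_add_right ?_ 1)
  rw [mul_div_assoc]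
  exact mul_le_of_le_one_right hai (div_le_one_of_le₀ (by linarith) (by positivity))
end
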